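/- For every integer n ≥ 1, every p > 2 and every μ' ∈ (0,1) there exist ε > 0 and C > 0 with the following property. Let J : ℝ^{2n} → End(ℝ^{2n}) be continuous with J(x) ∘ J(x) = −id for all x, sup_x ‖J(x) − J_st‖ < ε, and J(x) = J_st for all x ∈ ℝⁿ × {0}. Let u : D̄₊ → ℝ^{2n} be continuous and bounded, differentiable on the open half-disk D₊ with ∂u/∂x + J(u) ∂u/∂y = 0 there, with finite energy ∫_{D₊} ‖du‖² dA < ∞, and with u(D̄₊ ∩ ℝ) ⊂ ℝⁿ × {0}. Then for all z, z' ∈ μ'D̄₊ one has |u(z) − u(z')| ≤ C (sup_{D̄₊} |u|) |z − z'|^{1−2/p}. (Step 2 of the proof of Theorem 2.3: Hölder regularity up to the totally real boundary.) -/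

import Mathlib

open MeasureTheory

/-- The standard complex structure `J_st` on `ℝ^{2n} ≅ ℂ^n`, i.e. multiplication
by `i`. -/
noncomputable def Jstd (n : ℕ) : (Fin n → ℂ) →L[ℝ] (Fin n → ℂ) :=
  Complex.I • (ContinuousLinearMap.id ℝ (Fin n → ℂ))

/-- The open upper half-disk `D₊`. -/
def halfDisk : Set ℂ := {z | ‖z‖ < 1 ∧ 0 < z.im}

/-- The closed upper half-disk `μD̄₊` of radius `μ`. -/
def closedHalfDisk (μ : ℝ) : Set ℂ := {z | ‖z‖ ≤ μ ∧ 0 ≤ z.im}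

/-- The totally real subspace `ℝⁿ × {0} ⊂ ℝ^{2n} ≅ ℂ^n`. -/
def realSlice (n : ℕ) : Set (Fin n → ℂ) := {v | ∀ i, (v i).im = 0}

section Helpers

open Set Filter Topology

/-- The profile `t (1 - t²) / (t² + δ²)` with `t = exp (α s)`, whose square serves as an
energy weight: it vanishes at `s = 0` and at `-∞`, and behaves like `exp (-α s)` in between. -/
noncomputable def profile (α δ s : ℝ) : ℝ :=
  Real.exp (α * s) * (1 - Real.exp (α * s) ^ 2) / (Real.exp (α * s) ^ 2 + δ ^ 2)

/-- The derivative of `profile`. -/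
noncomputable def profileDeriv (α δ s : ℝ) : ℝ :=
  α * (profile α δ s * (δ ^ 2 - Real.exp (α * s) ^ 2) / (Real.exp (α * s) ^ 2 + δ ^ 2)
    - 2 * Real.exp (α * s) ^ 3 / (Real.exp (α * s) ^ 2 + δ ^ 2))

lemma profile_hasDerivAt (α δ s : ℝ) : HasDerivAt (profile α δ) (profileDeriv α δ s) s := by
  have ht : HasDerivAt (fun s => Real.exp (α * s)) (Real.exp (α * s) * α) s := by
    simpa using ((hasDerivAt_id s).const_mul α).exp
  have hpos : Real.exp (α * s) ^ 2 + δ ^ 2 ≠ 0 := by positivity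
  have h := (ht.mul ((hasDerivAt_const s (1 : ℝ)).sub (ht.pow 2))).div
    ((ht.pow 2).add_const (δ ^ 2)) hpos
  refine h.congr_deriv ?_
  simp only [profileDeriv, profile, Pi.mul_apply, Pi.sub_apply, Pi.pow_apply]
  set t := Real.exp (α * s)
  field_simp
  ring

lemma profile_zero (α δ : ℝ) : profile α δ 0 = 0 := by simp [profile]

lemma profile_contDiff (α δ : ℝ) : ContDiff ℝ 1 (profile α δ) := by
  unfold profile
  refine ContDiff.div (by fun_prop) (by fun_prop) fun s => by positivity

lemma exp_weight_le_one {α s : ℝ} (hα : 0 < α) (hs : s ≤ 0) : Real.exp (α * s) ≤ 1 :=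
  Real.exp_le_one_iff.2 (by nlinarith)

lemma profile_nonneg {α δ s : ℝ} (hα : 0 < α) (hs : s ≤ 0) : 0 ≤ profile α δ s := by
  have h1 := exp_weight_le_one hα hs
  have h0 := Real.exp_pos (α * s)
  unfold profile
  have : 0 ≤ 1 - Real.exp (α * s) ^ 2 := by nlinarith
  positivity

lemma profile_le {α δ s : ℝ} (hδ : 0 < δ) : profile α δ s ≤ Real.exp (α * s) / δ ^ 2 := by
  have h0 := Real.exp_pos (α * s)
  unfold profile
  gcongr
  · nlinarith
  · nlinarith

lemma abs_profileDeriv_le {α δ s : ℝ} (hα : 0 < α) (hs : s ≤ 0) : |profileDeriv α δ s| ≤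
    α * profile α δ s + 2 * α * Real.exp (α * s) := by
  have h0 := Real.exp_pos (α * s)
  have hg := profile_nonneg (δ := δ) hα hs
  unfold profileDeriv
  set t := Real.exp (α * s)
  set g := profile α δ s
  have hd : 0 < t ^ 2 + δ ^ 2 := by positivity
  have h1 : |g * (δ ^ 2 - t ^ 2) / (t ^ 2 + δ ^ 2)| ≤ g := by
    rw [abs_div, abs_mul, abs_of_nonneg hg, abs_of_pos hd, div_le_iff₀ hd]
    gcongr
    rw [abs_le]; constructor <;> nlinarith [sq_nonneg t, sq_nonneg δ]
  have h2 : |2 * t ^ 3 / (t ^ 2 + δ ^ 2)| ≤ 2 * t := by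
    rw [abs_of_nonneg (by positivity), div_le_iff₀ hd]
    nlinarith [mul_nonneg h0.le (sq_nonneg δ)]
  rw [abs_mul, abs_of_pos hα]
  calc _ ≤ α * (g + 2 * t) := by
        gcongr; exact (abs_sub _ _).trans (add_le_add h1 h2)
    _ = _ := by ring

/-- Integration by parts for `χ p²` where `p` is a primitive of an integrable function. -/
lemma integral_deriv_weight_mul_sq {χ p P : ℝ → ℝ} {a b : ℝ} (hab : a ≤ b)
    (hχ : ContDiff ℝ 1 χ) (hP : IntervalIntegrable P volume a b)
    (hp : ∀ s ∈ Icc a b, p s = p a + ∫ x in a..s, P x) :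
    ∫ s in a..b, (deriv χ s * p s ^ 2 + χ s * (2 * (p s * P s))) =
      χ b * p b ^ 2 - χ a * p a ^ 2 := by
  set q : ℝ → ℝ := fun s => p a + ∫ x in a..s, P x with hq
  have hqac : AbsolutelyContinuousOnInterval q a b := by
    have h1 : AbsolutelyContinuousOnInterval (fun _ : ℝ => p a) a b :=
      (contDiff_const (n := 1)).contDiffOn.absolutelyContinuousOnInterval
    exact h1.add (hP.absolutelyContinuousOnInterval_intervalIntegral (c := a) (by simp))
  have hχac : AbsolutelyContinuousOnInterval χ a b :=
    hχ.contDiffOn.absolutelyContinuousOnInterval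
  have hac : AbsolutelyContinuousOnInterval (fun s => χ s * (q s * q s)) a b :=
    hχac.fun_mul (hqac.fun_mul hqac)
  have h := hac.integral_deriv_eq_sub
  have hpq : ∀ s ∈ Icc a b, p s = q s := hp
  rw [hpq b (right_mem_Icc.2 hab), hpq a (left_mem_Icc.2 hab), sq, sq, ← h]
  refine intervalIntegral.integral_congr_ae ?_
  filter_upwards [hP.ae_hasDerivAt_integral] with x hx hxm
  have hxu := uIoc_subset_uIcc hxm
  have hqd : HasDerivAt q (P x) x := (hx hxu a (by simp)).const_add (p a)
  have hd := (hχ.differentiable (by norm_num) x).hasDerivAt.mul (hqd.mul hqd)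
  rw [uIcc_of_le hab] at hxu
  rw [show deriv (fun s => χ s * (q s * q s)) x = _ from hd.deriv, hpq x hxu]
  simp only [Pi.mul_apply]
  ring

lemma mode_pointwise {α m g d t : ℝ} (x y u v : ℝ) (hα : 0 < α) (hα1 : α < 1)
    (hm : |m| ≤ m ^ 2) (hg : 0 ≤ g) (hd : |d| ≤ α * g + 2 * α * t) :
    (1 - α) * (g ^ 2 * (m ^ 2 * (x ^ 2 + y ^ 2))) - 2 / (1 - α) * (g ^ 2 * (u ^ 2 + v ^ 2))
      - 8 / (1 - α) * (t ^ 2 * (x ^ 2 + y ^ 2)) ≤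
    m * ((2 * g * d * x ^ 2 + g ^ 2 * (2 * (x * (m * x + u)))) +
      (2 * g * d * y ^ 2 + g ^ 2 * (2 * (y * (m * y + v))))) := by
  have hγ : 0 < 1 - α := by linarith
  obtain ⟨γ, hγe⟩ : ∃ γ, γ = 1 - α := ⟨_, rfl⟩
  rw [← hγe] at hγ ⊢
  have e1 : ∀ a b : ℝ, 0 ≤ γ / 2 * m ^ 2 * a ^ 2 + 2 * m * a * b + 2 / γ * b ^ 2 := fun a b => by
    have : γ / 2 * m ^ 2 * a ^ 2 + 2 * m * a * b + 2 / γ * b ^ 2 =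
        γ / 2 * (m * a + 2 / γ * b) ^ 2 := by field_simp; ring
    rw [this]; positivity
  have e2 : 4 * α * |m| * g * t ≤ γ / 2 * m ^ 2 * g ^ 2 + 8 / γ * t ^ 2 := by
    have h1 : γ / 2 * m ^ 2 * g ^ 2 - 4 * α * |m| * g * t + 8 / γ * α ^ 2 * t ^ 2 =
        γ / 2 * (|m| * g - 4 * α / γ * t) ^ 2 := by
      rw [← sq_abs m]; field_simp; ring
    have h2 : 8 / γ * α ^ 2 * t ^ 2 ≤ 8 / γ * 1 * t ^ 2 := by gcongr; nlinarith
    have h3 : 0 ≤ γ / 2 * (|m| * g - 4 * α / γ * t) ^ 2 := by positivity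
    linarith
  have e3 : -(m * (2 * g * d)) ≤ 2 * α * m ^ 2 * g ^ 2 + γ / 2 * m ^ 2 * g ^ 2 + 8 / γ * t ^ 2 := by
    have h1 : -(m * (2 * g * d)) ≤ |m| * (2 * g * |d|) := by
      refine (neg_le_abs _).trans_eq ?_
      rw [abs_mul, abs_mul, abs_mul, abs_of_nonneg hg, abs_two]
    have h2 : |m| * (2 * g * |d|) ≤ |m| * (2 * g * (α * g + 2 * α * t)) := by gcongr
    have h3 : |m| * (2 * α * g ^ 2) ≤ m ^ 2 * (2 * α * g ^ 2) := by gcongr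
    linarith
  have hN : 0 ≤ x ^ 2 + y ^ 2 := by positivity
  have f1 := mul_le_mul_of_nonneg_right e3 hN
  have f2 := mul_nonneg (sq_nonneg g) (e1 x u)
  have f3 := mul_nonneg (sq_nonneg g) (e1 y v)
  have hα' : α = 1 - γ := by linarith
  subst hα'
  linarith

theorem mode_estimate {α δ : ℝ} (hα : 0 < α) (hα1 : α < 1) (hδ : 0 < δ) {m : ℝ} (hm : |m| ≤ m ^ 2)
    {a A f : ℝ → ℂ} {K : ℝ} (hK : ∀ s ≤ 0, ‖a s‖ ≤ K) (hac : ContinuousOn a (Iic 0))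
    (hA : ∀ S ≤ 0, IntervalIntegrable A volume S 0)
    (ha : ∀ S ≤ 0, ∀ s ∈ Icc S 0, a s = a S + ∫ x in S..s, A x)
    (hode : ∀ᵐ s, s ≤ 0 → A s = m * a s + f s)
    (hf : IntegrableOn (fun s => profile α δ s ^ 2 * ‖f s‖ ^ 2) (Iic 0)) :
    ∫ s in Iic 0, profile α δ s ^ 2 * (m ^ 2 * ‖a s‖ ^ 2) ≤
      2 / (1 - α) ^ 2 * (∫ s in Iic 0, profile α δ s ^ 2 * ‖f s‖ ^ 2) +
      8 / (1 - α) ^ 2 * ∫ s in Iic 0, Real.exp (α * s) ^ 2 * ‖a s‖ ^ 2 := by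
  set g := profile α δ with hg
  have hgc : Continuous g := (profile_contDiff α δ).continuous
  have hγ : 0 < 1 - α := by linarith
  set γ := 1 - α with hγdef
  have htint : IntegrableOn (fun s => Real.exp (α * s) ^ 2) (Iic 0) := by
    have := integrableOn_exp_mul_Iic (a := 2 * α) (by positivity) 0
    refine this.congr_fun (fun s _ => ?_) measurableSet_Iic
    simp only [← Real.exp_nat_mul]
    congr 1; push_cast; ring
  have hta : IntegrableOn (fun s => Real.exp (α * s) ^ 2 * ‖a s‖ ^ 2) (Iic 0) := by
    refine (htint.const_mul (K ^ 2)).mono' ?_ ?_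
    · exact (ContinuousOn.mul (by fun_prop) (hac.norm.pow 2)).aestronglyMeasurable
        measurableSet_Iic
    · filter_upwards [ae_restrict_mem measurableSet_Iic] with s hs
      rw [Real.norm_of_nonneg (by positivity), mul_comm]
      gcongr
      exact hK s hs
  have hga : IntegrableOn (fun s => g s ^ 2 * (m ^ 2 * ‖a s‖ ^ 2)) (Iic 0) := by
    refine (hta.const_mul (m ^ 2 / δ ^ 4)).mono' ?_ ?_
    · exact (ContinuousOn.mul (by fun_prop) (ContinuousOn.mul (by fun_prop)
        (hac.norm.pow 2))).aestronglyMeasurable measurableSet_Iic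
    · filter_upwards [ae_restrict_mem measurableSet_Iic] with s hs
      rw [Real.norm_of_nonneg (by positivity)]
      have h1 := profile_nonneg (δ := δ) hα hs
      have h2 := pow_le_pow_left₀ h1 (profile_le (α := α) (s := s) hδ) 2
      calc g s ^ 2 * (m ^ 2 * ‖a s‖ ^ 2)
          ≤ (Real.exp (α * s) / δ ^ 2) ^ 2 * (m ^ 2 * ‖a s‖ ^ 2) := by gcongr
        _ = _ := by field_simp
  set Φ : ℝ → ℝ := fun s => γ * (g s ^ 2 * (m ^ 2 * ‖a s‖ ^ 2))
    - 2 / γ * (g s ^ 2 * ‖f s‖ ^ 2) - 8 / γ * (Real.exp (α * s) ^ 2 * ‖a s‖ ^ 2) with hΦ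
  have hΦint : IntegrableOn Φ (Iic 0) :=
    ((hga.const_mul _).sub (hf.const_mul _)).sub (hta.const_mul _)
  have hχ : ContDiff ℝ 1 (fun s => g s ^ 2) := (profile_contDiff α δ).pow 2
  have hχd : ∀ s, deriv (fun s => g s ^ 2) s = 2 * g s * profileDeriv α δ s := fun s => by
    have := (profile_hasDerivAt α δ s).pow 2
    exact this.deriv.trans (by simp [hg])
  have hsq : ∀ z : ℂ, ‖z‖ ^ 2 = z.re ^ 2 + z.im ^ 2 := fun z => by
    rw [← Complex.normSq_eq_norm_sq, Complex.normSq_apply]; ring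
  have key : ∀ S ≤ 0, ∫ s in S..0, Φ s ≤ |m| * K ^ 2 * (Real.exp (α * S) / δ ^ 2) ^ 2 := by
    intro S hS
    have hAre : IntervalIntegrable (fun s => (A s).re) volume S 0 :=
      ⟨Complex.reCLM.integrable_comp (hA S hS).1, Complex.reCLM.integrable_comp (hA S hS).2⟩
    have hAim : IntervalIntegrable (fun s => (A s).im) volume S 0 :=
      ⟨Complex.imCLM.integrable_comp (hA S hS).1, Complex.imCLM.integrable_comp (hA S hS).2⟩
    have hsub : ∀ s ∈ Icc S 0, IntervalIntegrable A volume S s := fun s hs =>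
      (hA S hS).mono_set (by rw [uIcc_of_le hs.1, uIcc_of_le hS]; exact Icc_subset_Icc_right hs.2)
    have h1 := integral_deriv_weight_mul_sq hS hχ hAre fun s hs => by
      have := congrArg Complex.reCLM (ha S hS s hs)
      rwa [map_add, ← ContinuousLinearMap.intervalIntegral_comp_comm _ (hsub s hs)] at this
    have h2 := integral_deriv_weight_mul_sq hS hχ hAim fun s hs => by
      have := congrArg Complex.imCLM (ha S hS s hs)
      rwa [map_add, ← ContinuousLinearMap.intervalIntegral_comp_comm _ (hsub s hs)] at this
    have haS : ContinuousOn a (uIcc S 0) :=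
      hac.mono (by rw [uIcc_of_le hS]; exact Icc_subset_Iic_self)
    have hdc : Continuous (deriv fun s => g s ^ 2) := hχ.continuous_deriv le_rfl
    have hi : ∀ p P : ℝ → ℝ, ContinuousOn p (uIcc S 0) → IntervalIntegrable P volume S 0 →
        IntervalIntegrable (fun s => deriv (fun s => g s ^ 2) s * p s ^ 2 +
          g s ^ 2 * (2 * (p s * P s))) volume S 0 := fun p P hp hP => by
      refine IntervalIntegrable.add (ContinuousOn.intervalIntegrable (by fun_prop)) ?_
      exact ((hP.continuousOn_mul hp).const_mul 2).continuousOn_mul (by fun_prop)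
    have i1 := hi _ _ (Complex.continuous_re.comp_continuousOn haS) hAre
    have i2 := hi _ _ (Complex.continuous_im.comp_continuousOn haS) hAim
    have h3 := intervalIntegral.integral_add i1 i2
    have hΦS : IntervalIntegrable Φ volume S 0 := by
      rw [intervalIntegrable_iff_integrableOn_Ioc_of_le hS]
      exact hΦint.mono_set Ioc_subset_Iic_self
    have hmono := intervalIntegral.integral_mono_ae_restrict hS hΦS ((i1.add i2).const_mul m) (by
      filter_upwards [ae_restrict_mem measurableSet_Icc, ae_restrict_of_ae hode] with s hs hode
      have hs0 : s ≤ 0 := hs.2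
      have hd := abs_profileDeriv_le (δ := δ) hα hs0
      have hg0 : 0 ≤ g s := profile_nonneg hα hs0
      have hAs := hode hs0
      rw [hχd]
      have := mode_pointwise (a s).re (a s).im (f s).re (f s).im hα hα1 hm hg0 hd
      have hre : (A s).re = m * (a s).re + (f s).re := by simp [hAs]
      have him : (A s).im = m * (a s).im + (f s).im := by simp [hAs]
      simp only [hΦ, Function.comp, hre, him, hsq]
      exact this)
    rw [intervalIntegral.integral_const_mul] at hmono
    refine hmono.trans ?_
    simp only [Function.comp_def, Complex.reCLM_apply, Complex.imCLM_apply] at h1 h2 h3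
    refine (congrArg (m * ·) (h3.trans (congrArg₂ (· + ·) h1 h2))).le.trans ?_
    have h5 : g 0 = 0 := profile_zero α δ
    have h6 : (a S).re ^ 2 + (a S).im ^ 2 = ‖a S‖ ^ 2 := (hsq _).symm
    have h7 := pow_le_pow_left₀ (profile_nonneg (δ := δ) hα hS)
      (profile_le (α := α) (s := S) hδ) 2
    have h8 := pow_le_pow_left₀ (norm_nonneg _) (hK S hS) 2
    calc _ = -m * (g S ^ 2 * ‖a S‖ ^ 2) := by rw [h5, ← h6]; ring
      _ ≤ |m| * ((Real.exp (α * S) / δ ^ 2) ^ 2 * K ^ 2) := by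
        gcongr
        exact neg_le_abs m
      _ = _ := by ring
  have hlim := intervalIntegral_tendsto_integral_Iic 0 hΦint tendsto_id
  have hlim0 : Tendsto (fun S => |m| * K ^ 2 * (Real.exp (α * S) / δ ^ 2) ^ 2) atBot (𝓝 0) := by
    have : Tendsto (fun S => Real.exp (α * S)) atBot (𝓝 0) :=
      Real.tendsto_exp_atBot.comp (tendsto_id.const_mul_atBot hα)
    simpa using ((this.div_const (δ ^ 2)).pow 2).const_mul (|m| * K ^ 2)
  have hle : ∫ s in Iic 0, Φ s ≤ 0 :=
    le_of_tendsto_of_tendsto hlim hlim0 ((eventually_le_atBot 0).mono key)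
  simp only [hΦ] at hle
  have e1 := integral_sub ((hga.const_mul γ).sub (hf.const_mul (2 / γ))) (hta.const_mul (8 / γ))
  have e2 := integral_sub (hga.const_mul γ) (hf.const_mul (2 / γ))
  simp only [Pi.sub_apply] at e1 e2
  rw [e1, e2, integral_const_mul, integral_const_mul, integral_const_mul] at hle
  refine le_of_mul_le_mul_left ?_ hγ
  refine (sub_nonpos.1 (by linarith [hle])).trans_eq (b := 2 / γ * (∫ s in Iic 0, g s ^ 2 * ‖f s‖ ^ 2)
    + 8 / γ * ∫ s in Iic 0, Real.exp (α * s) ^ 2 * ‖a s‖ ^ 2) ?_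
  field_simp

lemma neg_pi_lt_pi : -Real.pi < Real.pi := by linarith [Real.pi_pos]

/-- The volume of the half-strip `(-∞, 0] × (-π, π]`. -/
noncomputable abbrev stripVolume : Measure (ℝ × ℝ) :=
  (volume.restrict (Iic (0 : ℝ))).prod (volume.restrict (Ioc (-Real.pi) Real.pi))

/-- A bounded continuous function `W` on the half-strip `s ≤ 0`, periodic in the angle `θ`,
with square integrable partial derivatives `Ws`, `Wθ` which exist off countable sets on
almost all coordinate lines. -/
structure IsStripFunction (W Ws Wθ : ℝ → ℝ → ℂ) (M : ℝ) : Prop where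
  cont : ContinuousOn (Function.uncurry W) (Iic 0 ×ˢ univ)
  bound : ∀ s ≤ 0, ∀ θ, ‖W s θ‖ ≤ M
  periodic : ∀ s ≤ 0, W s (-Real.pi) = W s Real.pi
  meas_s : Measurable (Function.uncurry Ws)
  meas_θ : Measurable (Function.uncurry Wθ)
  deriv_θ : ∀ s ≤ 0, ∃ N : Set ℝ, N.Countable ∧ ∀ θ ∉ N, HasDerivAt (W s) (Wθ s θ) θ
  deriv_s : ∀ᵐ θ : ℝ, ∃ N : Set ℝ, N.Countable ∧
    ∀ s < 0, s ∉ N → HasDerivAt (fun s => W s θ) (Ws s θ) s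
  energy_s : ∫⁻ p, ‖Ws p.1 p.2‖ₑ ^ 2 ∂stripVolume < ⊤
  energy_θ : ∫⁻ p, ‖Wθ p.1 p.2‖ₑ ^ 2 ∂stripVolume < ⊤

lemma enorm_sq_eq_ofReal (z : ℂ) : ‖z‖ₑ ^ 2 = ENNReal.ofReal (‖z‖ ^ 2) := by
  rw [ENNReal.ofReal_pow (norm_nonneg _), ofReal_norm]

lemma integrableOn_exp_sq {α : ℝ} (hα : 0 < α) :
    IntegrableOn (fun s => Real.exp (α * s) ^ 2) (Iic 0) := by
  have h := integrableOn_exp_mul_Iic (a := 2 * α) (by positivity) 0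
  refine h.congr_fun (fun s _ => ?_) measurableSet_Iic
  rw [← Real.exp_nat_mul]
  push_cast
  ring_nf

lemma memLp_two_of_lintegral {β : Type*} [MeasurableSpace β] {μ : Measure β} {f : β → ℂ}
    (hf : AEStronglyMeasurable f μ) (h : ∫⁻ x, ‖f x‖ₑ ^ 2 ∂μ < ⊤) : MemLp f 2 μ := by
  refine ⟨hf, ?_⟩
  rw [eLpNorm_lt_top_iff_lintegral_rpow_enorm_lt_top two_ne_zero ENNReal.ofNat_ne_top]
  simpa using h

/-- Parseval's identity on `(-π, π]` in terms of lower integrals. -/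
lemma tsum_enorm_sq_fourierCoeffOn {f : ℝ → ℂ}
    (hf : MemLp f 2 (volume.restrict (Ioc (-Real.pi) Real.pi))) :
    ∑' m : ℤ, ‖fourierCoeffOn neg_pi_lt_pi f m‖ₑ ^ 2 =
      ENNReal.ofReal (2 * Real.pi)⁻¹ * ∫⁻ θ in Ioc (-Real.pi) Real.pi, ‖f θ‖ₑ ^ 2 := by
  have h := hasSum_sq_fourierCoeffOn neg_pi_lt_pi hf
  have h1 : ∀ z : ℂ, ‖z‖ₑ ^ 2 = ENNReal.ofReal (‖z‖ ^ 2) := fun z => by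
    rw [ENNReal.ofReal_pow (norm_nonneg _), ofReal_norm]
  simp_rw [h1]
  rw [← ENNReal.ofReal_tsum_of_nonneg (fun _ => by positivity) h.summable, h.tsum_eq,
    intervalIntegral.integral_of_le neg_pi_lt_pi.le, smul_eq_mul,
    ENNReal.ofReal_mul (by simp [Real.pi_pos.le]),
    ofReal_integral_eq_lintegral_ofReal hf.integrable_norm_pow' (.of_forall fun _ => by positivity)]
  congr 3
  ring

lemma continuous_fourier_neg_coe (m : ℤ) :
    Continuous fun θ : ℝ => (fourier (-m) (θ : AddCircle (Real.pi - -Real.pi)) : ℂ) :=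
  (map_continuous (fourier (-m))).comp (AddCircle.continuous_mk' _)

lemma norm_fourier_coe (m : ℤ) (θ : ℝ) :
    ‖(fourier (-m) (θ : AddCircle (Real.pi - -Real.pi)) : ℂ)‖ = 1 := Circle.norm_coe _

lemma fourierCoeffOn_eq (f : ℝ → ℂ) (m : ℤ) :
    fourierCoeffOn neg_pi_lt_pi f m = (1 / (Real.pi - -Real.pi)) •
      ∫ θ in Ioc (-Real.pi) Real.pi, fourier (-m) (θ : AddCircle (Real.pi - -Real.pi)) * f θ := by
  rw [fourierCoeffOn_eq_integral, intervalIntegral.integral_of_le neg_pi_lt_pi.le]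
  rfl

/-- The Fourier coefficients of the derivative of a periodic function. -/
lemma fourierCoeffOn_deriv {F F' : ℝ → ℂ} {N : Set ℝ} (hN : N.Countable) (hc : Continuous F)
    (hper : F (-Real.pi) = F Real.pi) (hd : ∀ θ ∉ N, HasDerivAt F (F' θ) θ)
    (hi : IntegrableOn F' (Ioc (-Real.pi) Real.pi)) (m : ℤ) :
    fourierCoeffOn neg_pi_lt_pi F' m = Complex.I * (m * fourierCoeffOn neg_pi_lt_pi F m) := by
  have hT : ((Real.pi - -Real.pi : ℝ) : ℂ) ≠ 0 := by
    exact_mod_cast (by linarith [Real.pi_pos] : Real.pi - -Real.pi ≠ 0)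
  set e : ℝ → ℂ := fun θ => fourier (-m) (θ : AddCircle (Real.pi - -Real.pi)) with he
  have hec : Continuous e := continuous_fourier_neg_coe m
  have hed : ∀ θ, HasDerivAt e (-(Complex.I * m) * e θ) θ := fun θ => by
    refine (hasDerivAt_fourier_neg (Real.pi - -Real.pi) m θ).congr_deriv ?_
    rw [div_mul_eq_mul_div, div_eq_iff hT]
    push_cast
    ring
  have hi' : IntervalIntegrable F' volume (-Real.pi) Real.pi := by
    rwa [intervalIntegrable_iff_integrableOn_Ioc_of_le neg_pi_lt_pi.le]
  have hi1 : IntervalIntegrable (fun θ => -(Complex.I * m) * (e θ * F θ)) volume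
      (-Real.pi) Real.pi := Continuous.intervalIntegrable (by fun_prop) _ _
  have hi2 : IntervalIntegrable (fun θ => e θ * F' θ) volume (-Real.pi) Real.pi :=
    hi'.continuousOn_mul hec.continuousOn
  have h := integral_eq_of_hasDerivAt_off_countable_of_le (fun θ => e θ * F θ)
    (fun θ => -(Complex.I * m) * (e θ * F θ) + e θ * F' θ) neg_pi_lt_pi.le hN
    (hec.mul hc).continuousOn
    (fun θ hθ => ((hed θ).mul (hd θ hθ.2)).congr_deriv (by ring)) (hi1.add hi2)
  have hee : e (-Real.pi) = e Real.pi := by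
    have : ((Real.pi : ℝ) : AddCircle (Real.pi - -Real.pi)) = ((-Real.pi : ℝ) : AddCircle _) := by
      simpa using AddCircle.coe_add_period (Real.pi - -Real.pi) (-Real.pi)
    simp only [he, this]
  rw [intervalIntegral.integral_add hi1 hi2, intervalIntegral.integral_const_mul, hee, hper,
    sub_self] at h
  rw [fourierCoeffOn_eq_integral, fourierCoeffOn_eq_integral]
  simp only [smul_eq_mul]
  change _ • (∫ θ in _..Real.pi, e θ * F' θ) =
    Complex.I * (m * (_ • ∫ θ in _..Real.pi, e θ * F θ))
  rw [eq_neg_of_add_eq_zero_right h]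
  simp only [Complex.real_smul]
  ring

namespace IsStripFunction

variable {W Ws Wθ : ℝ → ℝ → ℂ} {M : ℝ}

lemma bound_nonneg (h : IsStripFunction W Ws Wθ M) : 0 ≤ M :=
  (norm_nonneg _).trans (h.bound 0 le_rfl 0)

lemma continuous_slice (h : IsStripFunction W Ws Wθ M) {s : ℝ} (hs : s ≤ 0) :
    Continuous (W s) := by
  rw [← continuousOn_univ]
  exact h.cont.comp (f := fun θ => (s, θ)) (by fun_prop) fun θ _ => ⟨hs, mem_univ _⟩

lemma continuousOn_ray (h : IsStripFunction W Ws Wθ M) (θ : ℝ) :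
    ContinuousOn (fun s => W s θ) (Iic 0) :=
  h.cont.comp (f := fun s => (s, θ)) (by fun_prop) fun s hs => ⟨hs, mem_univ _⟩

/-- Square integrability on the strip restricts to rectangles and gives integrability there. -/
lemma integrable_rectangle {g : ℝ → ℝ → ℂ} (hg : Measurable (Function.uncurry g))
    (h : ∫⁻ p, ‖g p.1 p.2‖ₑ ^ 2 ∂stripVolume < ⊤) (S : ℝ) :
    Integrable (Function.uncurry g)
      ((volume.restrict (Ioc S 0)).prod (volume.restrict (Ioc (-Real.pi) Real.pi))) := by
  have h1 : MemLp (Function.uncurry g) 2 stripVolume :=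
    memLp_two_of_lintegral hg.aestronglyMeasurable h
  have h2 : ((volume.restrict (Ioc S 0)).prod (volume.restrict (Ioc (-Real.pi) Real.pi))) ≤
      stripVolume := by
    rw [stripVolume, Measure.prod_restrict, Measure.prod_restrict]
    exact Measure.restrict_mono (prod_mono Ioc_subset_Iic_self subset_rfl) le_rfl
  exact (h1.mono_measure h2).integrable one_le_two

/-- Almost every slice of a square integrable function on the strip is square integrable. -/
lemma ae_memLp_slice {g : ℝ → ℝ → ℂ} (hg : Measurable (Function.uncurry g))
    (h : ∫⁻ p, ‖g p.1 p.2‖ₑ ^ 2 ∂stripVolume < ⊤) :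
    ∀ᵐ s ∂volume.restrict (Iic (0 : ℝ)),
      MemLp (g s) 2 (volume.restrict (Ioc (-Real.pi) Real.pi)) := by
  have hm : Measurable fun p : ℝ × ℝ => ‖g p.1 p.2‖ₑ ^ 2 := (hg.enorm.pow_const 2 :)
  rw [lintegral_prod _ hm.aemeasurable] at h
  filter_upwards [ae_lt_top hm.lintegral_prod_right' h.ne] with s hs
  exact memLp_two_of_lintegral (hg.comp measurable_prodMk_left).aestronglyMeasurable hs

/-- The `s`-derivative on a generic ray integrates to the increment. -/
lemma ae_ray (h : IsStripFunction W Ws Wθ M) (S : ℝ) :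
    ∀ᵐ θ ∂volume.restrict (Ioc (-Real.pi) Real.pi), IntegrableOn (fun s => Ws s θ) (Ioc S 0) ∧
      ∀ s ∈ Icc S 0, W s θ - W S θ = ∫ x in S..s, Ws x θ := by
  filter_upwards [(integrable_rectangle h.meas_s h.energy_s S).prod_left_ae,
    ae_restrict_of_ae h.deriv_s] with θ h1 ⟨N, hN, hd⟩
  refine ⟨h1, fun s hs => ?_⟩
  refine (integral_eq_of_hasDerivAt_off_countable_of_le (fun s => W s θ) _ hs.1 hN
    ((h.continuousOn_ray θ).mono fun x hx => hx.2.trans hs.2)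
    (fun x hx => hd x (hx.1.2.trans_le hs.2) hx.2) ?_).symm
  rw [intervalIntegrable_iff_integrableOn_Ioc_of_le hs.1]
  exact IntegrableOn.mono_set (t := Ioc S 0) h1 (Ioc_subset_Ioc_right hs.2)

lemma norm_fourierCoeffOn_le {g : ℝ → ℂ} {K : ℝ} (hg : ∀ θ, ‖g θ‖ ≤ K) (m : ℤ) :
    ‖fourierCoeffOn neg_pi_lt_pi g m‖ ≤ K := by
  rw [fourierCoeffOn_eq, norm_smul]
  have h1 : ‖∫ θ in Ioc (-Real.pi) Real.pi,
      fourier (-m) (θ : AddCircle (Real.pi - -Real.pi)) * g θ‖ ≤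
      K * (volume.restrict (Ioc (-Real.pi) Real.pi)).real univ :=
    norm_integral_le_of_norm_le_const (.of_forall fun θ => by
      rw [norm_mul, norm_fourier_coe, one_mul]; exact hg θ)
  have h2 : (volume.restrict (Ioc (-Real.pi) Real.pi)).real univ = Real.pi - -Real.pi := by
    rw [measureReal_restrict_apply_univ, Real.volume_real_Ioc_of_le neg_pi_lt_pi.le]
  rw [h2] at h1
  have hp := sub_pos.2 neg_pi_lt_pi
  rw [Real.norm_of_nonneg (by positivity), one_div, inv_mul_le_iff₀ hp]
  linarith

lemma continuousOn_coeff (h : IsStripFunction W Ws Wθ M) (m : ℤ) :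
    ContinuousOn (fun s => fourierCoeffOn neg_pi_lt_pi (W s) m) (Iic 0) := by
  simp only [fourierCoeffOn_eq]
  refine ContinuousOn.fun_const_smul ?_ _
  refine continuousOn_of_dominated (bound := fun _ => M) ?_ ?_ ?_ ?_
  · exact fun s hs => ((continuous_fourier_neg_coe m).mul
      (h.continuous_slice hs)).aestronglyMeasurable
  · refine fun s hs => .of_forall fun θ => ?_
    rw [norm_mul, norm_fourier_coe, one_mul]
    exact h.bound s hs θ
  · exact integrable_const _
  · exact .of_forall fun θ => continuousOn_const.mul (h.continuousOn_ray θ)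

lemma integrable_fourier_mul {g : ℝ → ℝ → ℂ} (hg : Measurable (Function.uncurry g))
    (h : ∫⁻ p, ‖g p.1 p.2‖ₑ ^ 2 ∂stripVolume < ⊤) (S : ℝ) (m : ℤ) :
    Integrable (fun p : ℝ × ℝ => (fourier (-m) (p.2 : AddCircle (Real.pi - -Real.pi)) : ℂ) *
        g p.1 p.2)
      ((volume.restrict (Ioc S 0)).prod (volume.restrict (Ioc (-Real.pi) Real.pi))) := by
  refine (integrable_rectangle hg h S).bdd_mul (c := 1) ?_ (.of_forall fun p => ?_)
  · exact ((continuous_fourier_neg_coe m).comp continuous_snd).aestronglyMeasurable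
  · exact (norm_fourier_coe m p.2).le

lemma intervalIntegrable_coeff {g : ℝ → ℝ → ℂ} (hg : Measurable (Function.uncurry g))
    (h : ∫⁻ p, ‖g p.1 p.2‖ₑ ^ 2 ∂stripVolume < ⊤) (m : ℤ) {S : ℝ} (hS : S ≤ 0) :
    IntervalIntegrable (fun s => fourierCoeffOn neg_pi_lt_pi (g s) m) volume S 0 := by
  rw [intervalIntegrable_iff_integrableOn_Ioc_of_le hS]
  simp only [fourierCoeffOn_eq]
  exact Integrable.smul (1 / (Real.pi - -Real.pi)) (integrable_fourier_mul hg h S m).integral_prod_left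

lemma coeff_eq_add_integral (h : IsStripFunction W Ws Wθ M) (m : ℤ) {S : ℝ} {s : ℝ}
    (hs : s ∈ Icc S 0) :
    fourierCoeffOn neg_pi_lt_pi (W s) m = fourierCoeffOn neg_pi_lt_pi (W S) m +
      ∫ x in S..s, fourierCoeffOn neg_pi_lt_pi (Ws x) m := by
  have hS : S ≤ 0 := hs.1.trans hs.2
  simp only [fourierCoeffOn_eq]
  rw [intervalIntegral.integral_smul, ← smul_add]
  congr 1
  have hle : (volume.restrict (Ioc S s)).prod (volume.restrict (Ioc (-Real.pi) Real.pi)) ≤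
      (volume.restrict (Ioc S 0)).prod (volume.restrict (Ioc (-Real.pi) Real.pi)) := by
    rw [Measure.prod_restrict, Measure.prod_restrict]
    exact Measure.restrict_mono (prod_mono (Ioc_subset_Ioc_right hs.2) subset_rfl) le_rfl
  rw [intervalIntegral.integral_of_le hs.1, integral_integral_swap
    ((integrable_fourier_mul h.meas_s h.energy_s S m).mono_measure hle), ← sub_eq_iff_eq_add',
    ← integral_sub]
  · refine integral_congr_ae ?_
    filter_upwards [h.ae_ray S] with θ ⟨_, hθ⟩
    rw [← mul_sub, hθ s hs, intervalIntegral.integral_of_le hs.1, integral_const_mul]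
  · exact (((continuous_fourier_neg_coe m).mul (h.continuous_slice hs.2)).intervalIntegrable
      (-Real.pi) Real.pi).1
  · exact (((continuous_fourier_neg_coe m).mul (h.continuous_slice hS)).intervalIntegrable
      (-Real.pi) Real.pi).1

/-- Fourier expansion of the equation `Ws + i Wθ = f`. -/
lemma ae_coeff_ode (h : IsStripFunction W Ws Wθ M) (m : ℤ) :
    ∀ᵐ s ∂volume.restrict (Iic (0 : ℝ)), fourierCoeffOn neg_pi_lt_pi (Ws s) m =
      ((m : ℝ) : ℂ) * fourierCoeffOn neg_pi_lt_pi (W s) m +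
        fourierCoeffOn neg_pi_lt_pi (fun θ => Ws s θ + Complex.I * Wθ s θ) m := by
  filter_upwards [ae_memLp_slice h.meas_s h.energy_s, ae_memLp_slice h.meas_θ h.energy_θ,
    ae_restrict_mem measurableSet_Iic] with s h1 h2 hs
  obtain ⟨N, hN, hd⟩ := h.deriv_θ s hs
  have h3 := fourierCoeffOn_deriv hN (h.continuous_slice hs) (h.periodic s hs) hd
    (h2.integrable one_le_two) m
  have hint : ∀ g : ℝ → ℂ, MemLp g 2 (volume.restrict (Ioc (-Real.pi) Real.pi)) →
      Integrable (fun θ : ℝ => (fourier (-m) (θ : AddCircle (Real.pi - -Real.pi)) : ℂ) * g θ)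
        (volume.restrict (Ioc (-Real.pi) Real.pi)) := fun g hg =>
    (hg.integrable one_le_two).bdd_mul (c := 1)
      (continuous_fourier_neg_coe m).aestronglyMeasurable
      (.of_forall fun θ => (norm_fourier_coe m θ).le)
  have h4 : fourierCoeffOn neg_pi_lt_pi (fun θ => Ws s θ + Complex.I * Wθ s θ) m =
      fourierCoeffOn neg_pi_lt_pi (Ws s) m +
        Complex.I * fourierCoeffOn neg_pi_lt_pi (Wθ s) m := by
    simp only [fourierCoeffOn_eq, mul_add]
    rw [integral_add (hint _ h1) (hint _ (h2.const_mul _)), smul_add]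
    simp only [mul_left_comm _ Complex.I, integral_const_mul]
    rw [mul_smul_comm]
  rw [h4, h3]
  push_cast
  linear_combination (-(m : ℂ) * fourierCoeffOn neg_pi_lt_pi (W s) m) * Complex.I_sq

end IsStripFunction

namespace IsStripFunction

variable {W Ws Wθ : ℝ → ℝ → ℂ} {M : ℝ}

lemma meas_residual (h : IsStripFunction W Ws Wθ M) :
    Measurable (Function.uncurry fun s θ => Ws s θ + Complex.I * Wθ s θ) :=
  h.meas_s.add (h.meas_θ.const_mul Complex.I)

lemma energy_residual (h : IsStripFunction W Ws Wθ M) :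
    ∫⁻ p, ‖Ws p.1 p.2 + Complex.I * Wθ p.1 p.2‖ₑ ^ 2 ∂stripVolume < ⊤ := by
  have h1 : MemLp (Function.uncurry Ws) 2 stripVolume :=
    memLp_two_of_lintegral h.meas_s.aestronglyMeasurable h.energy_s
  have h2 : MemLp (Function.uncurry Wθ) 2 stripVolume :=
    memLp_two_of_lintegral h.meas_θ.aestronglyMeasurable h.energy_θ
  have h3 := (h1.add (h2.const_mul Complex.I)).2
  rw [eLpNorm_lt_top_iff_lintegral_rpow_enorm_lt_top two_ne_zero ENNReal.ofNat_ne_top] at h3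
  simpa [Function.uncurry] using h3

lemma measurable_coeff {g : ℝ → ℝ → ℂ} (hg : Measurable (Function.uncurry g)) (m : ℤ) :
    Measurable fun s => fourierCoeffOn neg_pi_lt_pi (g s) m := by
  simp only [fourierCoeffOn_eq]
  refine Measurable.fun_const_smul (StronglyMeasurable.measurable ?_) (1 / (Real.pi - -Real.pi))
  refine StronglyMeasurable.integral_prod_right (f := fun s (θ : ℝ) =>
    fourier (-m) (θ : AddCircle (Real.pi - -Real.pi)) * g s θ) (Measurable.stronglyMeasurable ?_)
  exact ((continuous_fourier_neg_coe m).measurable.comp measurable_snd).mul hg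

/-- The energy of a single Fourier coefficient is controlled by the energy on the strip. -/
lemma coeff_energy_lt_top {g : ℝ → ℝ → ℂ} (hg : Measurable (Function.uncurry g))
    (h : ∫⁻ p, ‖g p.1 p.2‖ₑ ^ 2 ∂stripVolume < ⊤) (m : ℤ) :
    ∫⁻ s in Iic (0 : ℝ), ‖fourierCoeffOn neg_pi_lt_pi (g s) m‖ₑ ^ 2 < ⊤ := by
  have hm : Measurable fun p : ℝ × ℝ => ‖g p.1 p.2‖ₑ ^ 2 := (hg.enorm.pow_const 2 :)
  have h' := h
  rw [lintegral_prod _ hm.aemeasurable] at h'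
  calc ∫⁻ s in Iic (0 : ℝ), ‖fourierCoeffOn neg_pi_lt_pi (g s) m‖ₑ ^ 2
      ≤ ∫⁻ s in Iic (0 : ℝ), ENNReal.ofReal (2 * Real.pi)⁻¹ *
          ∫⁻ θ in Ioc (-Real.pi) Real.pi, ‖g s θ‖ₑ ^ 2 := by
        refine lintegral_mono_ae ?_
        filter_upwards [ae_memLp_slice hg h] with s hs
        rw [← tsum_enorm_sq_fourierCoeffOn hs]
        exact ENNReal.le_tsum m
    _ < ⊤ := by
        rw [lintegral_const_mul _ hm.lintegral_prod_right']
        exact ENNReal.mul_lt_top ENNReal.ofReal_lt_top h'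

lemma lintegral_mode_estimate (h : IsStripFunction W Ws Wθ M) {α δ : ℝ} (hα : 0 < α)
    (hα1 : α < 1) (hδ : 0 < δ) (m : ℤ) :
    ∫⁻ s in Iic 0, ENNReal.ofReal (profile α δ s ^ 2) *
        ‖fourierCoeffOn neg_pi_lt_pi (Wθ s) m‖ₑ ^ 2 ≤
      ENNReal.ofReal (2 / (1 - α) ^ 2) * (∫⁻ s in Iic 0, ENNReal.ofReal (profile α δ s ^ 2) *
        ‖fourierCoeffOn neg_pi_lt_pi (fun θ => Ws s θ + Complex.I * Wθ s θ) m‖ₑ ^ 2) +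
      ENNReal.ofReal (8 / (1 - α) ^ 2) * ∫⁻ s in Iic 0, ENNReal.ofReal (Real.exp (α * s) ^ 2) *
        ‖fourierCoeffOn neg_pi_lt_pi (W s) m‖ₑ ^ 2 := by
  set a := fun s => fourierCoeffOn neg_pi_lt_pi (W s) m with ha
  set f := fun s => fourierCoeffOn neg_pi_lt_pi (fun θ => Ws s θ + Complex.I * Wθ s θ) m with hf
  have hpc : Continuous (profile α δ) := (profile_contDiff α δ).continuous
  have hM := h.bound_nonneg
  have haK : ∀ s ≤ 0, ‖a s‖ ≤ M := fun s hs => norm_fourierCoeffOn_le (h.bound s hs) m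
  have hac : ContinuousOn a (Iic 0) := h.continuousOn_coeff m
  have hp1 : ∀ s ≤ 0, profile α δ s ^ 2 ≤ 1 / δ ^ 4 * Real.exp (α * s) ^ 2 := fun s hs => by
    have h1 := pow_le_pow_left₀ (profile_nonneg hα hs) (profile_le (α := α) (s := s) hδ) 2
    refine h1.trans_eq ?_
    field_simp
  have hp2 : ∀ s ≤ 0, profile α δ s ^ 2 ≤ 1 / δ ^ 4 := fun s hs =>
    (hp1 s hs).trans (mul_le_of_le_one_right (by positivity)
      (pow_le_one₀ (Real.exp_pos _).le (exp_weight_le_one hα hs)))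
  have hτ : IntegrableOn (fun s => Real.exp (α * s) ^ 2 * ‖a s‖ ^ 2) (Iic 0) := by
    refine ((integrableOn_exp_sq hα).mul_const (M ^ 2)).mono' ?_ ?_
    · exact ContinuousOn.aestronglyMeasurable (by fun_prop) measurableSet_Iic
    · filter_upwards [ae_restrict_mem measurableSet_Iic] with s hs
      rw [Real.norm_of_nonneg (by positivity)]
      gcongr
      exact haK s hs
  have hω : IntegrableOn (fun s => profile α δ s ^ 2 * ((m : ℝ) ^ 2 * ‖a s‖ ^ 2)) (Iic 0) := by
    refine (hτ.const_mul (1 / δ ^ 4 * (m : ℝ) ^ 2)).mono' ?_ ?_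
    · exact ContinuousOn.aestronglyMeasurable (by fun_prop) measurableSet_Iic
    · filter_upwards [ae_restrict_mem measurableSet_Iic] with s hs
      rw [Real.norm_of_nonneg (by positivity)]
      nlinarith [mul_le_mul_of_nonneg_right (hp1 s hs)
        (by positivity : 0 ≤ (m : ℝ) ^ 2 * ‖a s‖ ^ 2)]
  have hfm : Measurable f := measurable_coeff h.meas_residual m
  have hf2 : IntegrableOn (fun s => profile α δ s ^ 2 * ‖f s‖ ^ 2) (Iic 0) := by
    have h1 : IntegrableOn (fun s => ‖f s‖ ^ 2) (Iic 0) :=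
      (memLp_two_of_lintegral hfm.aestronglyMeasurable
        (coeff_energy_lt_top h.meas_residual h.energy_residual m)).integrable_norm_pow two_ne_zero
    refine Integrable.bdd_mul (c := 1 / δ ^ 4) h1 (by fun_prop) ?_
    filter_upwards [ae_restrict_mem measurableSet_Iic] with s hs
    rw [Real.norm_of_nonneg (by positivity)]
    exact hp2 s hs
  have hode := h.ae_coeff_ode m
  rw [ae_restrict_iff' measurableSet_Iic] at hode
  have hm : |(m : ℝ)| ≤ (m : ℝ) ^ 2 := by
    have : |m| ≤ m ^ 2 := by
      rw [← sq_abs]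
      exact Int.le_self_sq _
    exact_mod_cast this
  have key := mode_estimate hα hα1 hδ hm haK hac
    (fun S hS => intervalIntegrable_coeff h.meas_s h.energy_s m hS)
    (fun S _ s hs => h.coeff_eq_add_integral m hs) hode hf2
  have hL : ∫⁻ s in Iic 0, ENNReal.ofReal (profile α δ s ^ 2) *
      ‖fourierCoeffOn neg_pi_lt_pi (Wθ s) m‖ₑ ^ 2 =
      ENNReal.ofReal (∫ s in Iic 0, profile α δ s ^ 2 * ((m : ℝ) ^ 2 * ‖a s‖ ^ 2)) := by
    rw [ofReal_integral_eq_lintegral_ofReal hω (.of_forall fun s => by positivity)]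
    refine lintegral_congr_ae ?_
    filter_upwards [ae_memLp_slice h.meas_θ h.energy_θ, ae_restrict_mem measurableSet_Iic]
      with s h2 hs
    obtain ⟨N, hN, hd⟩ := h.deriv_θ s hs
    rw [fourierCoeffOn_deriv hN (h.continuous_slice hs) (h.periodic s hs) hd
      (h2.integrable one_le_two) m, ENNReal.ofReal_mul (by positivity), enorm_sq_eq_ofReal,
      norm_mul, norm_mul, Complex.norm_I, one_mul, mul_pow, Complex.norm_intCast, sq_abs]
  have hRf : ∫⁻ s in Iic 0, ENNReal.ofReal (profile α δ s ^ 2) * ‖f s‖ₑ ^ 2 =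
      ENNReal.ofReal (∫ s in Iic 0, profile α δ s ^ 2 * ‖f s‖ ^ 2) := by
    rw [ofReal_integral_eq_lintegral_ofReal hf2 (.of_forall fun s => by positivity)]
    simp only [enorm_sq_eq_ofReal, ENNReal.ofReal_mul (sq_nonneg _)]
  have hRa : ∫⁻ s in Iic 0, ENNReal.ofReal (Real.exp (α * s) ^ 2) * ‖a s‖ₑ ^ 2 =
      ENNReal.ofReal (∫ s in Iic 0, Real.exp (α * s) ^ 2 * ‖a s‖ ^ 2) := by
    rw [ofReal_integral_eq_lintegral_ofReal hτ (.of_forall fun s => by positivity)]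
    simp only [enorm_sq_eq_ofReal, ENNReal.ofReal_mul (sq_nonneg _)]
  rw [hL, hRf, hRa, ← ENNReal.ofReal_mul (by positivity), ← ENNReal.ofReal_mul (by positivity),
    ← ENNReal.ofReal_add (mul_nonneg (by positivity) (integral_nonneg fun s => by positivity))
      (mul_nonneg (by positivity) (integral_nonneg fun s => by positivity))]
  exact ENNReal.ofReal_le_ofReal key

/-- Parseval's identity integrated against a weight on the half-strip. -/
lemma tsum_lintegral_weight {g : ℝ → ℝ → ℂ} {w : ℝ → ENNReal} (hw : Measurable w)
    (hm : ∀ m : ℤ, AEMeasurable (fun s => fourierCoeffOn neg_pi_lt_pi (g s) m)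
      (volume.restrict (Iic (0 : ℝ))))
    (hg : ∀ᵐ s ∂volume.restrict (Iic (0 : ℝ)),
      MemLp (g s) 2 (volume.restrict (Ioc (-Real.pi) Real.pi))) :
    ∑' m : ℤ, ∫⁻ s in Iic (0 : ℝ), w s * ‖fourierCoeffOn neg_pi_lt_pi (g s) m‖ₑ ^ 2 =
      ENNReal.ofReal (2 * Real.pi)⁻¹ *
        ∫⁻ s in Iic (0 : ℝ), w s * ∫⁻ θ in Ioc (-Real.pi) Real.pi, ‖g s θ‖ₑ ^ 2 := by
  rw [← lintegral_tsum fun m => hw.aemeasurable.fun_mul ((hm m).enorm.pow_const 2),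
    ← lintegral_const_mul' _ _ ENNReal.ofReal_ne_top]
  refine lintegral_congr_ae ?_
  filter_upwards [hg] with s hs
  rw [ENNReal.tsum_mul_left, tsum_enorm_sq_fourierCoeffOn hs, mul_left_comm]

/-- Weighted `L²` estimate for the operator `∂ₛ + i ∂_θ` on the half-strip. -/
theorem weighted_estimate (h : IsStripFunction W Ws Wθ M) {α δ : ℝ} (hα : 0 < α)
    (hα1 : α < 1) (hδ : 0 < δ) :
    ∫⁻ s in Iic 0, ENNReal.ofReal (profile α δ s ^ 2) *
        ∫⁻ θ in Ioc (-Real.pi) Real.pi, ‖Wθ s θ‖ₑ ^ 2 ≤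
      ENNReal.ofReal (2 / (1 - α) ^ 2) * (∫⁻ s in Iic 0, ENNReal.ofReal (profile α δ s ^ 2) *
        ∫⁻ θ in Ioc (-Real.pi) Real.pi, ‖Ws s θ + Complex.I * Wθ s θ‖ₑ ^ 2) +
      ENNReal.ofReal (8 / (1 - α) ^ 2) * ∫⁻ s in Iic 0, ENNReal.ofReal (Real.exp (α * s) ^ 2) *
        ∫⁻ θ in Ioc (-Real.pi) Real.pi, ‖W s θ‖ₑ ^ 2 := by
  have hpc : Continuous (profile α δ) := (profile_contDiff α δ).continuous
  have hw : Measurable fun s => ENNReal.ofReal (profile α δ s ^ 2) := by fun_prop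
  have hw' : Measurable fun s => ENNReal.ofReal (Real.exp (α * s) ^ 2) := by fun_prop
  have e1 := tsum_lintegral_weight hw (fun m => (measurable_coeff h.meas_θ m).aemeasurable)
    (ae_memLp_slice h.meas_θ h.energy_θ)
  have e2 := tsum_lintegral_weight hw (fun m => (measurable_coeff h.meas_residual m).aemeasurable)
    (ae_memLp_slice h.meas_residual h.energy_residual)
  have e3 := tsum_lintegral_weight (g := W) hw'
    (fun m => (h.continuousOn_coeff m).aemeasurable measurableSet_Iic) (by
      filter_upwards [ae_restrict_mem measurableSet_Iic] with s hs
      exact MemLp.of_bound (h.continuous_slice hs).aestronglyMeasurable M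
        (.of_forall (h.bound s hs)))
  have hsum := ENNReal.tsum_le_tsum (h.lintegral_mode_estimate hα hα1 hδ)
  rw [ENNReal.tsum_add, ENNReal.tsum_mul_left, ENNReal.tsum_mul_left, e1, e2, e3,
    mul_left_comm (ENNReal.ofReal (2 / _)), mul_left_comm (ENNReal.ofReal (8 / _)), ← mul_add] at hsum
  have hpi : (0 : ℝ) < (2 * Real.pi)⁻¹ := by positivity
  exact (ENNReal.mul_le_mul_iff_right (by simpa using Real.pi_pos) ENNReal.ofReal_ne_top).1 hsum

end IsStripFunction

lemma ENNReal.le_two_mul_of_le_half_add {x y : ENNReal} (hx : x ≠ ⊤) (h : x ≤ x / 2 + y) :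
    x ≤ 2 * y := by
  have h1 : x / 2 + x / 2 ≤ x / 2 + y := by rwa [ENNReal.add_halves]
  have h2 : x / 2 ≤ y :=
    ENNReal.le_of_add_le_add_left (ENNReal.div_lt_top hx two_ne_zero).ne h1
  rw [← ENNReal.add_halves x, two_mul]
  exact add_le_add h2 h2

/-- The constant in the weighted energy estimate on the half-strip. -/
noncomputable def stripConstant (n : ℕ) (α : ℝ) : ℝ :=
  2 * (n * (8 / (1 - α) ^ 2 * (2 * Real.pi * (1 / (2 * α)))))

lemma integral_exp_sq {α : ℝ} (hα : 0 < α) :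
    ∫ s in Iic 0, Real.exp (α * s) ^ 2 = 1 / (2 * α) := by
  have h := integral_exp_mul_Iic (a := 2 * α) (by positivity) 0
  simp only [mul_zero, Real.exp_zero] at h
  rw [← h]
  refine setIntegral_congr_fun measurableSet_Iic fun s _ => ?_
  rw [← Real.exp_nat_mul]
  push_cast
  ring_nf

namespace IsStripFunction

lemma lintegral_weight_sq_le {W Ws Wθ : ℝ → ℝ → ℂ} {M : ℝ} (h : IsStripFunction W Ws Wθ M)
    {α : ℝ} (hα : 0 < α) :
    ∫⁻ s in Iic 0, ENNReal.ofReal (Real.exp (α * s) ^ 2) *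
        ∫⁻ θ in Ioc (-Real.pi) Real.pi, ‖W s θ‖ₑ ^ 2 ≤
      ENNReal.ofReal (2 * Real.pi * (1 / (2 * α)) * M ^ 2) := by
  have hM := h.bound_nonneg
  have h1 : ∀ s ∈ Iic (0 : ℝ), ENNReal.ofReal (Real.exp (α * s) ^ 2) *
      ∫⁻ θ in Ioc (-Real.pi) Real.pi, ‖W s θ‖ₑ ^ 2 ≤
      ENNReal.ofReal (Real.exp (α * s) ^ 2) * ENNReal.ofReal (2 * Real.pi * M ^ 2) := fun s hs => by
    gcongr
    calc ∫⁻ θ in Ioc (-Real.pi) Real.pi, ‖W s θ‖ₑ ^ 2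
        ≤ ∫⁻ θ in Ioc (-Real.pi) Real.pi, ENNReal.ofReal (M ^ 2) := by
          refine lintegral_mono fun θ => ?_
          rw [enorm_sq_eq_ofReal]
          have := h.bound s hs θ
          gcongr
      _ = ENNReal.ofReal (2 * Real.pi * M ^ 2) := by
          rw [setLIntegral_const, Real.volume_Ioc, ← ENNReal.ofReal_mul (by positivity)]
          congr 1
          ring
  refine (setLIntegral_mono' measurableSet_Iic h1).trans_eq ?_
  rw [lintegral_mul_const' _ _ ENNReal.ofReal_ne_top,
    ← ofReal_integral_eq_lintegral_ofReal (integrableOn_exp_sq hα)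
      (.of_forall fun s => by positivity), integral_exp_sq hα,
    ← ENNReal.ofReal_mul (by positivity)]
  congr 1
  ring

lemma lintegral_profile_lt_top {g : ℝ → ℝ → ℂ} (hg : Measurable (Function.uncurry g))
    (h : ∫⁻ p, ‖g p.1 p.2‖ₑ ^ 2 ∂stripVolume < ⊤) {α δ : ℝ} (hα : 0 < α) (hδ : 0 < δ) :
    ∫⁻ s in Iic 0, ENNReal.ofReal (profile α δ s ^ 2) *
        ∫⁻ θ in Ioc (-Real.pi) Real.pi, ‖g s θ‖ₑ ^ 2 < ⊤ := by
  have hm : Measurable fun p : ℝ × ℝ => ‖g p.1 p.2‖ₑ ^ 2 := (hg.enorm.pow_const 2 :)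
  rw [lintegral_prod _ hm.aemeasurable] at h
  refine lt_of_le_of_lt (setLIntegral_mono' (g := fun s => ENNReal.ofReal (1 / δ ^ 4) *
    ∫⁻ θ in Ioc (-Real.pi) Real.pi, ‖g s θ‖ₑ ^ 2) measurableSet_Iic fun s hs => ?_) ?_
  · gcongr
    have h1 := pow_le_pow_left₀ (profile_nonneg hα hs) (profile_le (α := α) (s := s) hδ) 2
    calc profile α δ s ^ 2 ≤ (Real.exp (α * s) / δ ^ 2) ^ 2 := h1
      _ ≤ (1 / δ ^ 2) ^ 2 := by
        gcongr
        exact exp_weight_le_one hα hs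
      _ = 1 / δ ^ 4 := by ring
  · rw [lintegral_const_mul' _ _ ENNReal.ofReal_ne_top]
    exact ENNReal.mul_lt_top ENNReal.ofReal_lt_top h

end IsStripFunction

/-- Weighted energy estimate for a strip map with small `∂ₛ + i ∂_θ`. -/
theorem system_estimate {n : ℕ} {W Ws Wθ : Fin n → ℝ → ℝ → ℂ} {M : ℝ}
    (h : ∀ j, IsStripFunction (W j) (Ws j) (Wθ j) M) {α δ : ℝ} (hα : 0 < α)
    (hα1 : α < 1) (hδ : 0 < δ) {κ : ℝ} (hκ0 : 0 ≤ κ) (hκ : 2 / (1 - α) ^ 2 * (n * κ) ≤ 1 / 2)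
    (hres : ∀ s ≤ 0, ∀ᵐ θ, ∀ j, ‖Ws j s θ + Complex.I * Wθ j s θ‖ₑ ^ 2 ≤
      ENNReal.ofReal κ * ∑ i, ‖Wθ i s θ‖ₑ ^ 2) (j : Fin n) :
    ∫⁻ s in Iic 0, ENNReal.ofReal (profile α δ s ^ 2) *
        ∫⁻ θ in Ioc (-Real.pi) Real.pi, ‖Ws j s θ‖ₑ ^ 2 ≤
      ENNReal.ofReal (4 * stripConstant n α * M ^ 2) := by
  have hpc : Continuous (profile α δ) := (profile_contDiff α δ).continuous
  have hw : Measurable fun s => ENNReal.ofReal (profile α δ s ^ 2) := by fun_prop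
  set Q : (ℝ → ℝ → ℂ) → ENNReal := fun g => ∫⁻ s in Iic 0, ENNReal.ofReal (profile α δ s ^ 2) *
    ∫⁻ θ in Ioc (-Real.pi) Real.pi, ‖g s θ‖ₑ ^ 2 with hQ
  set E := ∑ i, Q (Wθ i) with hE
  have hpos : 0 < 1 - α := by linarith
  have hEtop : E ≠ ⊤ := (ENNReal.sum_lt_top.2 fun i _ =>
    IsStripFunction.lintegral_profile_lt_top (h i).meas_θ (h i).energy_θ hα hδ).ne
  have hmi : ∀ i, Measurable fun s => ∫⁻ θ in Ioc (-Real.pi) Real.pi, ‖Wθ i s θ‖ₑ ^ 2 :=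
    fun i => Measurable.lintegral_prod_right' (f := fun p : ℝ × ℝ => ‖Wθ i p.1 p.2‖ₑ ^ 2)
      ((h i).meas_θ.enorm.pow_const 2 :)
  have hms : ∀ i s, Measurable fun θ => ‖Wθ i s θ‖ₑ ^ 2 := fun i s =>
    (((h i).meas_θ.comp measurable_prodMk_left).enorm.pow_const 2 :)
  have hR : ∀ j, Q (fun s θ => Ws j s θ + Complex.I * Wθ j s θ) ≤ ENNReal.ofReal κ * E := by
    intro j
    calc Q (fun s θ => Ws j s θ + Complex.I * Wθ j s θ)
        ≤ ∫⁻ s in Iic 0, ENNReal.ofReal κ * ∑ i, ENNReal.ofReal (profile α δ s ^ 2) *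
          ∫⁻ θ in Ioc (-Real.pi) Real.pi, ‖Wθ i s θ‖ₑ ^ 2 := by
          refine setLIntegral_mono' measurableSet_Iic fun s hs => ?_
          rw [← Finset.mul_sum, mul_left_comm]
          gcongr
          rw [← lintegral_finsetSum _ fun i _ => hms i s,
            ← lintegral_const_mul' _ _ ENNReal.ofReal_ne_top]
          refine lintegral_mono_ae (ae_restrict_of_ae ?_)
          filter_upwards [hres s hs] with θ hθ using hθ j
      _ = ENNReal.ofReal κ * E := by
          rw [lintegral_const_mul' _ _ ENNReal.ofReal_ne_top,
            lintegral_finsetSum _ fun i _ => hw.fun_mul (hmi i)]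
  have hj : ∀ j, Q (Wθ j) ≤ ENNReal.ofReal (2 / (1 - α) ^ 2) * (ENNReal.ofReal κ * E) +
      ENNReal.ofReal (8 / (1 - α) ^ 2 * (2 * Real.pi * (1 / (2 * α)) * M ^ 2)) := fun j => by
    refine ((h j).weighted_estimate hα hα1 hδ).trans ?_
    rw [ENNReal.ofReal_mul (p := 8 / (1 - α) ^ 2) (by positivity)]
    gcongr
    · exact hR j
    · exact (h j).lintegral_weight_sq_le hα
  have hEle : E ≤ ENNReal.ofReal (stripConstant n α * M ^ 2) := by
    have h1 : E ≤ E / 2 + ENNReal.ofReal (n * (8 / (1 - α) ^ 2 *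
        (2 * Real.pi * (1 / (2 * α)) * M ^ 2))) := by
      refine (Finset.sum_le_sum fun j _ => hj j).trans ?_
      rw [Finset.sum_const, Finset.card_univ, Fintype.card_fin, nsmul_eq_mul, mul_add,
        ENNReal.ofReal_mul (Nat.cast_nonneg n), ENNReal.ofReal_natCast]
      gcongr
      calc (n : ENNReal) * (ENNReal.ofReal (2 / (1 - α) ^ 2) * (ENNReal.ofReal κ * E))
          = ENNReal.ofReal (2 / (1 - α) ^ 2 * (n * κ)) * E := by
            rw [ENNReal.ofReal_mul (by positivity), ENNReal.ofReal_mul (Nat.cast_nonneg n),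
              ENNReal.ofReal_natCast]
            ring
        _ ≤ ENNReal.ofReal (1 / 2) * E := by gcongr
        _ = E / 2 := by
            rw [one_div, ENNReal.ofReal_inv_of_pos two_pos, ENNReal.ofReal_ofNat, mul_comm]
            rfl
    refine (ENNReal.le_two_mul_of_le_half_add hEtop h1).trans_eq ?_
    rw [← ENNReal.ofReal_ofNat 2, ← ENNReal.ofReal_mul (by norm_num), stripConstant]
    congr 1
    ring
  have hκ1 : κ ≤ 1 := by
    have hn : (1 : ℝ) ≤ n := by exact_mod_cast j.pos
    have h1 : (1 : ℝ) ≤ 2 / (1 - α) ^ 2 := by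
      rw [le_div_iff₀ (by positivity)]
      nlinarith
    nlinarith [mul_le_mul hn le_rfl hκ0 (by positivity),
      mul_le_mul h1 (le_refl (n * κ)) (by positivity) (by positivity)]
  calc Q (Ws j) ≤ ∫⁻ s in Iic 0, (2 * (ENNReal.ofReal (profile α δ s ^ 2) *
        ∫⁻ θ in Ioc (-Real.pi) Real.pi, ‖Ws j s θ + Complex.I * Wθ j s θ‖ₑ ^ 2) +
        2 * (ENNReal.ofReal (profile α δ s ^ 2) *
          ∫⁻ θ in Ioc (-Real.pi) Real.pi, ‖Wθ j s θ‖ₑ ^ 2)) := by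
        refine lintegral_mono fun s => ?_
        rw [mul_left_comm, mul_left_comm 2, ← mul_add]
        gcongr
        rw [← lintegral_const_mul' _ _ ENNReal.ofNat_ne_top,
          ← lintegral_const_mul' _ _ ENNReal.ofNat_ne_top,
          ← lintegral_add_right _ ((hms j s).const_mul 2)]
        refine lintegral_mono fun θ => ?_
        simp only [enorm_sq_eq_ofReal, ← ENNReal.ofReal_ofNat 2]
        rw [← ENNReal.ofReal_mul (by norm_num), ← ENNReal.ofReal_mul (by norm_num),
          ← ENNReal.ofReal_add (by positivity) (by positivity)]
        refine ENNReal.ofReal_le_ofReal ?_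
        have h1 : ‖Ws j s θ‖ ≤ ‖Ws j s θ + Complex.I * Wθ j s θ‖ + ‖Wθ j s θ‖ := by
          calc ‖Ws j s θ‖ = ‖(Ws j s θ + Complex.I * Wθ j s θ) - Complex.I * Wθ j s θ‖ := by
                congr 1; ring
            _ ≤ _ := (norm_sub_le _ _).trans_eq (by rw [norm_mul, Complex.norm_I, one_mul])
        nlinarith [norm_nonneg (Ws j s θ), pow_le_pow_left₀ (norm_nonneg _) h1 2,
          sq_nonneg (‖Ws j s θ + Complex.I * Wθ j s θ‖ - ‖Wθ j s θ‖)]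
    _ = 2 * Q (fun s θ => Ws j s θ + Complex.I * Wθ j s θ) + 2 * Q (Wθ j) := by
        rw [lintegral_add_right _ ((hw.fun_mul (hmi j)).const_mul 2),
          lintegral_const_mul' _ _ ENNReal.ofNat_ne_top,
          lintegral_const_mul' _ _ ENNReal.ofNat_ne_top]
    _ ≤ 2 * (1 * E) + 2 * E := by
        gcongr
        · refine (hR j).trans ?_
          gcongr
          exact ENNReal.ofReal_le_one.2 hκ1
        · exact Finset.single_le_sum (f := fun i => Q (Wθ i)) (fun _ _ => zero_le)
            (Finset.mem_univ j)
    _ = 4 * E := by ring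
    _ ≤ 4 * ENNReal.ofReal (stripConstant n α * M ^ 2) := by gcongr
    _ = ENNReal.ofReal (4 * stripConstant n α * M ^ 2) := by
        rw [← ENNReal.ofReal_ofNat 4, ← ENNReal.ofReal_mul (by norm_num), mul_assoc]

lemma inv_profile_le {α S s b : ℝ} (hα : 0 < α) (hb : 0 < b) (hS : S ≤ s)
    (hs : Real.exp (α * s) ^ 2 ≤ 1 - b) :
    0 < profile α (Real.exp (α * S)) s ∧
      (profile α (Real.exp (α * S)) s)⁻¹ ≤ 2 / b * Real.exp (α * s) := by
  have h0 := Real.exp_pos (α * s)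
  have h1 : Real.exp (α * S) ≤ Real.exp (α * s) := Real.exp_le_exp.2 (by gcongr)
  have h2 := Real.exp_pos (α * S)
  unfold profile
  set t := Real.exp (α * s)
  set d := Real.exp (α * S)
  have h3 : 0 < 1 - t ^ 2 := by linarith
  refine ⟨by positivity, ?_⟩
  rw [inv_div, div_le_iff₀ (by positivity)]
  have h4 : t ^ 2 + d ^ 2 ≤ 2 * t ^ 2 := by nlinarith
  refine h4.trans ?_
  rw [div_mul_eq_mul_div, div_mul_eq_mul_div, le_div_iff₀ hb]
  nlinarith [mul_le_mul_of_nonneg_left hs (sq_nonneg t)]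

lemma lintegral_sq_le {μ : Measure ℝ} {g k : ℝ → ENNReal} {p : ℝ → ℝ} (hg : AEMeasurable g μ)
    (hp : Measurable p) (hpos : ∀ᵐ s ∂μ, 0 < p s ∧ ENNReal.ofReal (p s)⁻¹ ≤ k s) :
    (∫⁻ s, g s ∂μ) ^ 2 ≤ (∫⁻ s, ENNReal.ofReal (p s ^ 2) * g s ^ 2 ∂μ) * ∫⁻ s, k s ^ 2 ∂μ := by
  have h := ENNReal.lintegral_mul_le_Lp_mul_Lq μ Real.HolderConjugate.two_two
    (f := fun s => ENNReal.ofReal (p s) * g s) (g := fun s => ENNReal.ofReal (p s)⁻¹)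
    (hp.ennreal_ofReal.aemeasurable.mul hg) hp.inv.ennreal_ofReal.aemeasurable
  have e1 : ∫⁻ s, g s ∂μ = ∫⁻ s, ((fun s => ENNReal.ofReal (p s) * g s) *
      fun s => ENNReal.ofReal (p s)⁻¹) s ∂μ := by
    refine lintegral_congr_ae ?_
    filter_upwards [hpos] with s hs
    rw [Pi.mul_apply, mul_right_comm, ← ENNReal.ofReal_mul hs.1.le, mul_inv_cancel₀ hs.1.ne',
      ENNReal.ofReal_one, one_mul]
  rw [← e1] at h
  calc (∫⁻ s, g s ∂μ) ^ 2 ≤ _ := pow_le_pow_left' h 2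
    _ = (∫⁻ s, ENNReal.ofReal (p s) ^ 2 * g s ^ 2 ∂μ) * ∫⁻ s, ENNReal.ofReal (p s)⁻¹ ^ 2 ∂μ := by
        have hsq : ∀ x : ENNReal, (x ^ (1 / 2 : ℝ)) ^ 2 = x := fun x => by
          rw [← ENNReal.rpow_natCast, ← ENNReal.rpow_mul]
          norm_num
        rw [mul_pow, hsq, hsq]
        simp only [ENNReal.rpow_two, mul_pow]
    _ ≤ _ := by
        gcongr ?_ * ?_
        · refine lintegral_mono_ae ?_
          filter_upwards [hpos] with s hs
          rw [ENNReal.ofReal_pow hs.1.le]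
        · refine lintegral_mono_ae ?_
          filter_upwards [hpos] with s hs
          gcongr
          exact hs.2

namespace IsStripFunction

variable {W Ws Wθ W' Ws' Wθ' : ℝ → ℝ → ℂ} {M : ℝ}

lemma measurable_ray_length (h : IsStripFunction W Ws Wθ M) (S T : ℝ) :
    Measurable fun θ => ∫⁻ s in Ioc S T, ‖Ws s θ‖ₑ :=
  Measurable.lintegral_prod_left' (f := fun p : ℝ × ℝ => ‖Ws p.1 p.2‖ₑ) (h.meas_s.enorm :)

/-- The weighted energy controls the mean square length of the rays. -/
lemma ray_length_sq_le (h : IsStripFunction W Ws Wθ M) {α b S T K : ℝ} (hα : 0 < α)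
    (hb : 0 < b) (hT : T ≤ 0) (hTb : Real.exp (α * T) ^ 2 ≤ 1 - b) (hK0 : 0 ≤ K)
    (hK : ∫⁻ s in Iic 0, ENNReal.ofReal (profile α (Real.exp (α * S)) s ^ 2) *
        ∫⁻ θ in Ioc (-Real.pi) Real.pi, ‖Ws s θ‖ₑ ^ 2 ≤ ENNReal.ofReal K) :
    ∫⁻ θ in Ioc (-Real.pi) Real.pi, (∫⁻ s in Ioc S T, ‖Ws s θ‖ₑ) ^ 2 ≤
      ENNReal.ofReal (K * (2 / (α * b ^ 2) * Real.exp (α * T) ^ 2)) := by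
  set p := profile α (Real.exp (α * S)) with hp
  have hpc : Continuous p := (profile_contDiff α _).continuous
  have hexp : ∫⁻ s in Ioc S T, ENNReal.ofReal (2 / b * Real.exp (α * s)) ^ 2 ≤
      ENNReal.ofReal (2 / (α * b ^ 2) * Real.exp (α * T) ^ 2) := by
    refine (lintegral_mono_set Ioc_subset_Iic_self).trans_eq ?_
    have h1 : ∀ s, ENNReal.ofReal (2 / b * Real.exp (α * s)) ^ 2 =
        ENNReal.ofReal (4 / b ^ 2 * Real.exp (2 * α * s)) := fun s => by
      rw [← ENNReal.ofReal_pow (by positivity), mul_pow, ← Real.exp_nat_mul]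
      congr 1
      push_cast
      ring_nf
    simp only [h1]
    rw [← ofReal_integral_eq_lintegral_ofReal
      ((integrableOn_exp_mul_Iic (by positivity) T).const_mul _)
      (.of_forall fun s => by positivity), integral_const_mul, integral_exp_mul_Iic (by positivity),
      ← Real.exp_nat_mul]
    congr 1
    field_simp
    push_cast
    ring_nf
  have hkey : ∀ θ, (∫⁻ s in Ioc S T, ‖Ws s θ‖ₑ) ^ 2 ≤
      (∫⁻ s in Ioc S T, ENNReal.ofReal (p s ^ 2) * ‖Ws s θ‖ₑ ^ 2) *
        ENNReal.ofReal (2 / (α * b ^ 2) * Real.exp (α * T) ^ 2) := fun θ => by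
    refine (lintegral_sq_le (p := p) (k := fun s => ENNReal.ofReal (2 / b * Real.exp (α * s)))
      (h.meas_s.comp measurable_prodMk_right).enorm.aemeasurable hpc.measurable ?_).trans
      (mul_le_mul_right hexp _)
    filter_upwards [ae_restrict_mem measurableSet_Ioc] with s hs
    have hs2 : Real.exp (α * s) ^ 2 ≤ 1 - b := le_trans (by gcongr; exact hs.2) hTb
    obtain ⟨h1, h2⟩ := inv_profile_le hα hb hs.1.le hs2
    exact ⟨h1, ENNReal.ofReal_le_ofReal h2⟩
  have hmeas : Measurable fun q : ℝ × ℝ => ENNReal.ofReal (p q.1 ^ 2) * ‖Ws q.1 q.2‖ₑ ^ 2 :=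
    (by fun_prop : Measurable fun q : ℝ × ℝ => ENNReal.ofReal (p q.1 ^ 2)).mul
      (h.meas_s.enorm.pow_const 2)
  calc ∫⁻ θ in Ioc (-Real.pi) Real.pi, (∫⁻ s in Ioc S T, ‖Ws s θ‖ₑ) ^ 2
      ≤ ∫⁻ θ in Ioc (-Real.pi) Real.pi,
        (∫⁻ s in Ioc S T, ENNReal.ofReal (p s ^ 2) * ‖Ws s θ‖ₑ ^ 2) *
          ENNReal.ofReal (2 / (α * b ^ 2) * Real.exp (α * T) ^ 2) := lintegral_mono hkey
    _ = (∫⁻ s in Ioc S T, ENNReal.ofReal (p s ^ 2) *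
          ∫⁻ θ in Ioc (-Real.pi) Real.pi, ‖Ws s θ‖ₑ ^ 2) *
          ENNReal.ofReal (2 / (α * b ^ 2) * Real.exp (α * T) ^ 2) := by
        rw [lintegral_mul_const' _ _ ENNReal.ofReal_ne_top,
          lintegral_lintegral_swap (f := fun θ s => ENNReal.ofReal (p s ^ 2) * ‖Ws s θ‖ₑ ^ 2)
            (hmeas.comp measurable_swap).aemeasurable]
        simp only [lintegral_const_mul' _ _ ENNReal.ofReal_ne_top]
    _ ≤ ENNReal.ofReal K * ENNReal.ofReal (2 / (α * b ^ 2) * Real.exp (α * T) ^ 2) := by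
        gcongr
        exact (lintegral_mono_set (Ioc_subset_Iic_self.trans (Iic_subset_Iic.2 hT))).trans hK
    _ = _ := (ENNReal.ofReal_mul hK0).symm

/-- The increment along a generic ray is bounded by its length. -/
lemma ae_increment_le (h : IsStripFunction W Ws Wθ M) {S T : ℝ} (hT : T ≤ 0) :
    ∀ᵐ θ : ℝ, θ ∈ Ioc (-Real.pi) Real.pi → ∀ s ∈ Icc S T,
      ‖W s θ - W S θ‖ₑ ≤ ∫⁻ s in Ioc S T, ‖Ws s θ‖ₑ := by
  have h1 := h.ae_ray S
  rw [ae_restrict_iff' measurableSet_Ioc] at h1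
  filter_upwards [h1] with θ hθ hθ' s hs
  rw [(hθ hθ').2 s ⟨hs.1, hs.2.trans hT⟩, intervalIntegral.integral_of_le hs.1]
  exact (enorm_integral_le_lintegral_enorm _).trans (lintegral_mono_set (Ioc_subset_Ioc_right hs.2))

/-- Two strip functions whose rays meet have nearby values at their ends. -/
lemma norm_sub_le_of_meet (h : IsStripFunction W Ws Wθ M) (h' : IsStripFunction W' Ws' Wθ' M)
    {S T B η : ℝ} (hT : T ≤ 0) (hB0 : 0 ≤ B)
    (hB : ∫⁻ θ in Ioc (-Real.pi) Real.pi, (∫⁻ s in Ioc S T, ‖Ws s θ‖ₑ) ^ 2 ≤ ENNReal.ofReal B)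
    (hB' : ∫⁻ θ in Ioc (-Real.pi) Real.pi, (∫⁻ s in Ioc S T, ‖Ws' s θ‖ₑ) ^ 2 ≤ ENNReal.ofReal B)
    {w w' : ℂ} (hη : ∀ θ, ‖W S θ - w‖ ≤ η) (hη' : ∀ θ, ‖W' S θ - w'‖ ≤ η)
    (hmeet : ∀ φ ∈ Icc (-(Real.pi / 4)) (Real.pi / 4), ∃ s ∈ Icc S T, W s φ = W' s (-φ)) :
    ‖w - w'‖ ≤ 2 * Real.sqrt B + 2 * η := by
  set G : ℝ → ENNReal := fun θ => ∫⁻ s in Ioc S T, ‖Ws s θ‖ₑ with hG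
  set G' : ℝ → ENNReal := fun θ => ∫⁻ s in Ioc S T, ‖Ws' s θ‖ₑ with hG'
  have hGm : Measurable G := h.measurable_ray_length S T
  have hGm' : Measurable G' := h'.measurable_ray_length S T
  have hpi := Real.pi_pos
  by_contra! hcon
  set D := ‖w - w'‖ - 2 * η with hD
  have hD0 : 2 * Real.sqrt B < D := by linarith
  set A := Icc (-(Real.pi / 4)) (Real.pi / 4) with hA
  have hAsub : A ⊆ Ioc (-Real.pi) Real.pi := fun x hx =>
    ⟨by linarith [hx.1], by linarith [hx.2]⟩
  have hneg : ∀ {φ : ℝ}, φ ∈ A → -φ ∈ A := fun {φ} hφ => ⟨by linarith [hφ.2], by linarith [hφ.1]⟩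
  have hrefl := (Measure.measurePreserving_neg (volume : Measure ℝ)).quasiMeasurePreserving.ae
    (h'.ae_increment_le (S := S) hT)
  have hpt : ∀ᵐ φ ∂volume.restrict A, ENNReal.ofReal (D ^ 2) ≤ 2 * G φ ^ 2 + 2 * G' (-φ) ^ 2 := by
    rw [ae_restrict_iff' measurableSet_Icc]
    filter_upwards [h.ae_increment_le (S := S) hT, hrefl] with φ h1 h2 hφ
    obtain ⟨s, hs, hss⟩ := hmeet φ hφ
    have e1 := h1 (hAsub hφ) s hs
    have e2 := h2 (hAsub (hneg hφ)) s hs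
    have e3 : D ≤ ‖W s φ - W S φ‖ + ‖W' s (-φ) - W' S (-φ)‖ := by
      have e6 : w - w' = (W' s (-φ) - W' S (-φ)) - (W s φ - W S φ) - (W S φ - w) +
          (W' S (-φ) - w') := by
        rw [hss]; ring
      have e7 := norm_add_le ((W' s (-φ) - W' S (-φ)) - (W s φ - W S φ) - (W S φ - w))
        (W' S (-φ) - w')
      have e8 := norm_sub_le ((W' s (-φ) - W' S (-φ)) - (W s φ - W S φ)) (W S φ - w)
      have e9 := norm_sub_le (W' s (-φ) - W' S (-φ)) (W s φ - W S φ)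
      rw [← e6] at e7
      linarith [hη φ, hη' (-φ)]
    calc ENNReal.ofReal (D ^ 2) ≤ ENNReal.ofReal
          (2 * ‖W s φ - W S φ‖ ^ 2 + 2 * ‖W' s (-φ) - W' S (-φ)‖ ^ 2) := by
          refine ENNReal.ofReal_le_ofReal ?_
          nlinarith [pow_le_pow_left₀ (by linarith [Real.sqrt_nonneg B]) e3 2,
            sq_nonneg (‖W s φ - W S φ‖ - ‖W' s (-φ) - W' S (-φ)‖)]
      _ = 2 * ‖W s φ - W S φ‖ₑ ^ 2 + 2 * ‖W' s (-φ) - W' S (-φ)‖ₑ ^ 2 := by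
          rw [enorm_sq_eq_ofReal, enorm_sq_eq_ofReal, ENNReal.ofReal_add (by positivity)
            (by positivity), ENNReal.ofReal_mul (by norm_num), ENNReal.ofReal_mul (by norm_num),
            ENNReal.ofReal_ofNat]
      _ ≤ _ := by gcongr
  have hrefl2 : ∫⁻ φ in A, G' (-φ) ^ 2 = ∫⁻ φ in A, G' φ ^ 2 := by
    have := (Measure.measurePreserving_neg (volume : Measure ℝ)).setLIntegral_comp_preimage
      (measurableSet_Icc : MeasurableSet A) (hGm'.pow_const 2)
    rwa [show (Neg.neg ⁻¹' A : Set ℝ) = A from by ext x; exact ⟨fun hx => by simpa using hneg hx, hneg⟩]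
      at this
  have hint : ENNReal.ofReal (D ^ 2 * (Real.pi / 2)) ≤ ENNReal.ofReal (4 * B) := by
    calc ENNReal.ofReal (D ^ 2 * (Real.pi / 2)) = ∫⁻ φ in A, ENNReal.ofReal (D ^ 2) := by
          rw [setLIntegral_const, hA, Real.volume_Icc, ← ENNReal.ofReal_mul (by positivity)]
          congr 2
          ring
      _ ≤ ∫⁻ φ in A, (2 * G φ ^ 2 + 2 * G' (-φ) ^ 2) := lintegral_mono_ae hpt
      _ = 2 * (∫⁻ φ in A, G φ ^ 2) + 2 * ∫⁻ φ in A, G' φ ^ 2 := by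
          rw [lintegral_add_left ((hGm.pow_const 2).const_mul 2),
            lintegral_const_mul' _ _ ENNReal.ofNat_ne_top,
            lintegral_const_mul' _ _ ENNReal.ofNat_ne_top, hrefl2]
      _ ≤ 2 * ENNReal.ofReal B + 2 * ENNReal.ofReal B := by
          gcongr
          · exact (lintegral_mono_set hAsub).trans hB
          · exact (lintegral_mono_set hAsub).trans hB'
      _ = ENNReal.ofReal (4 * B) := by
          rw [ENNReal.ofReal_mul (by norm_num), ENNReal.ofReal_ofNat]
          ring
  rw [ENNReal.ofReal_le_ofReal_iff (by positivity)] at hint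
  have h4B : 4 * B < D ^ 2 := by
    nlinarith [Real.sq_sqrt hB0, Real.sqrt_nonneg B]
  nlinarith [Real.pi_gt_three, sq_nonneg D]

end IsStripFunction

/-- A bounded continuous map on the closed unit disk, differentiable off the real line, with
finite energy, and satisfying the Cauchy-Riemann equation up to a relative error `ε`. -/
structure IsDiskMap {n : ℕ} (v : ℂ → Fin n → ℂ) (M ε : ℝ) : Prop where
  cont : ContinuousOn v (Metric.closedBall 0 1)
  bound : ∀ z ∈ Metric.closedBall (0 : ℂ) 1, ‖v z‖ ≤ M
  diff : ∀ z ∈ Metric.ball (0 : ℂ) 1, z.im ≠ 0 → DifferentiableAt ℝ v z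
  residual : ∀ z ∈ Metric.ball (0 : ℂ) 1, z.im ≠ 0 →
    ‖fderiv ℝ v z 1 + Complex.I • fderiv ℝ v z Complex.I‖ ≤ ε * ‖fderiv ℝ v z Complex.I‖
  energy : ∫⁻ z in Metric.ball (0 : ℂ) 1, ‖fderiv ℝ v z‖ₑ ^ 2 < ⊤

/-- Logarithmic polar coordinates centred at `z₀`. -/
noncomputable def logPolar (z₀ c : ℂ) (s θ : ℝ) : ℂ := z₀ + c * Complex.exp (s + θ * Complex.I)

lemma logPolar_eq (z₀ c : ℂ) (s θ : ℝ) :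
    logPolar z₀ c s θ = z₀ + c * (Real.exp s * Complex.exp (θ * Complex.I)) := by
  rw [logPolar, Complex.exp_add, Complex.ofReal_exp]

lemma norm_logPolar_sub (z₀ c : ℂ) (s θ : ℝ) : ‖logPolar z₀ c s θ - z₀‖ = ‖c‖ * Real.exp s := by
  rw [logPolar, add_sub_cancel_left, norm_mul, Complex.norm_exp]
  simp

lemma logPolar_mem_ball {z₀ c : ℂ} (h : ‖z₀‖ + ‖c‖ < 1) {s : ℝ} (hs : s ≤ 0) (θ : ℝ) :
    logPolar z₀ c s θ ∈ Metric.ball (0 : ℂ) 1 := by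
  rw [mem_ball_zero_iff]
  have h1 := norm_logPolar_sub z₀ c s θ
  have h2 := norm_sub_norm_le (logPolar z₀ c s θ) z₀
  have h3 : Real.exp s ≤ 1 := Real.exp_le_one_iff.2 hs
  nlinarith [norm_nonneg c]

lemma continuous_logPolar (z₀ c : ℂ) : Continuous (Function.uncurry (logPolar z₀ c)) := by
  unfold logPolar Function.uncurry
  fun_prop

lemma hasDerivAt_logPolar_left (z₀ c : ℂ) (s θ : ℝ) :
    HasDerivAt (fun s => logPolar z₀ c s θ) (c * Complex.exp (s + θ * Complex.I)) s := by
  have h : HasDerivAt (fun s : ℝ => (s : ℂ) + θ * Complex.I) 1 s :=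
    Complex.ofRealCLM.hasDerivAt.add_const _
  simpa [logPolar] using (h.cexp.const_mul c).const_add z₀

lemma hasDerivAt_logPolar_right (z₀ c : ℂ) (s θ : ℝ) :
    HasDerivAt (logPolar z₀ c s) (Complex.I * (c * Complex.exp (s + θ * Complex.I))) θ := by
  have h : HasDerivAt (fun θ : ℝ => (s : ℂ) + θ * Complex.I) (1 * Complex.I) θ :=
    (Complex.ofRealCLM.hasDerivAt.mul_const Complex.I).const_add _
  refine ((h.cexp.const_mul c).const_add z₀).congr_deriv ?_
  ring

/-- A circle meets the real line in finitely many points. -/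
lemma finite_circle_inter_real (z₀ : ℂ) {c : ℂ} (hc : c ≠ 0) :
    {w : ℂ | ‖w‖ = 1 ∧ (z₀ + c * w).im = 0}.Finite := by
  classical
  set P : Polynomial ℂ := Polynomial.C c * Polynomial.X ^ 2 +
    Polynomial.C (z₀ - (starRingEnd ℂ) z₀) * Polynomial.X + Polynomial.C (-(starRingEnd ℂ) c) with hP
  have hP0 : P ≠ 0 := by
    intro h
    have h2 : P.coeff 2 = c := by
      simp only [hP, Polynomial.coeff_add, Polynomial.coeff_C_mul, Polynomial.coeff_X_pow,
        Polynomial.coeff_X, Polynomial.coeff_C]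
      norm_num
    rw [h, Polynomial.coeff_zero] at h2
    exact hc h2.symm
  refine (Polynomial.finite_setOfPred_isRoot hP0).subset ?_
  rintro w ⟨hw, him⟩
  have h1 : w * (starRingEnd ℂ) w = 1 := by
    rw [Complex.mul_conj, Complex.normSq_eq_norm_sq, hw]
    simp
  have h2 : (starRingEnd ℂ) (z₀ + c * w) = z₀ + c * w := Complex.conj_eq_iff_im.2 him
  simp only [map_add, map_mul] at h2
  change P.eval w = 0
  simp only [hP, Polynomial.eval_add, Polynomial.eval_mul, Polynomial.eval_C, Polynomial.eval_pow,
    Polynomial.eval_X]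
  linear_combination (-w) * h2 + (starRingEnd ℂ) c * h1

lemma countable_logPolar_im (z₀ : ℂ) {c : ℂ} (hc : c ≠ 0) (s : ℝ) :
    {θ : ℝ | (logPolar z₀ c s θ).im = 0}.Countable := by
  have hc' : c * Real.exp s ≠ 0 :=
    mul_ne_zero hc (Complex.ofReal_ne_zero.2 (Real.exp_pos s).ne')
  refine ((finite_circle_inter_real z₀ hc').countable.preimage_circleMap 0 one_ne_zero).mono ?_
  intro θ hθ
  rw [mem_ofPred_eq, logPolar_eq] at hθ
  refine ⟨by simp [circleMap], ?_⟩
  rw [← hθ]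
  simp [circleMap, mul_assoc]

lemma ae_countable_logPolar_im (z₀ : ℂ) {c : ℂ} (hc : c ≠ 0) :
    ∀ᵐ θ : ℝ, {s : ℝ | (logPolar z₀ c s θ).im = 0}.Countable := by
  filter_upwards [(countable_logPolar_im 0 hc 0).ae_notMem volume] with θ hθ
  refine Set.Subsingleton.countable ?_
  have hk : (c * Complex.exp (θ * Complex.I)).im ≠ 0 := by
    simpa [logPolar] using hθ
  have hform : ∀ s, (logPolar z₀ c s θ).im =
      z₀.im + Real.exp s * (c * Complex.exp (θ * Complex.I)).im := fun s => by
    rw [logPolar_eq, mul_left_comm, Complex.add_im, Complex.im_ofReal_mul]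
  intro s hs t ht
  rw [mem_ofPred_eq, hform] at hs ht
  exact Real.exp_injective (mul_right_cancel₀ hk (by linarith))

lemma det_smul_one (l : ℂ) : (l • (1 : ℂ →L[ℝ] ℂ)).det = ‖l‖ ^ 2 := by
  rw [ContinuousLinearMap.det]
  have h1 : ((l • (1 : ℂ →L[ℝ] ℂ) : ℂ →L[ℝ] ℂ) : ℂ →ₗ[ℝ] ℂ) = LinearMap.mulLeft ℝ l := by
    ext
    simp
  have h2 : LinearMap.det (LinearMap.mulLeft ℝ l) = Algebra.norm ℝ l := rfl
  rw [h1, h2, Algebra.norm_complex_apply, Complex.normSq_eq_norm_sq]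

/-- Conformal invariance of the energy under logarithmic polar coordinates. -/
lemma lintegral_logPolar_le {z₀ c : ℂ} (h : ‖z₀‖ + ‖c‖ < 1) (hc : c ≠ 0) (g : ℂ → ENNReal) :
    ∫⁻ p, ENNReal.ofReal (‖c * Complex.exp (p.1 + p.2 * Complex.I)‖ ^ 2) *
      g (logPolar z₀ c p.1 p.2) ∂stripVolume ≤ ∫⁻ z in Metric.ball (0 : ℂ) 1, g z := by
  set Ω : Set (ℝ × ℝ) := Iic 0 ×ˢ Ioc (-Real.pi) Real.pi with hΩ
  have hΩm : MeasurableSet Ω := measurableSet_Iic.prod measurableSet_Ioc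
  set Φ : ℂ → ℂ := fun ζ => z₀ + c * Complex.exp ζ with hΦ
  set S : Set ℂ := Complex.measurableEquivRealProd ⁻¹' Ω with hS
  have hSm : MeasurableSet S := Complex.measurableEquivRealProd.measurable hΩm
  have hd : ∀ ζ ∈ S, HasFDerivWithinAt Φ ((c * Complex.exp ζ) • (1 : ℂ →L[ℝ] ℂ)) S ζ := by
    intro ζ _
    have h1 : HasDerivAt Φ (c * Complex.exp ζ) ζ :=
      ((Complex.hasDerivAt_exp ζ).const_mul c).const_add z₀
    refine (h1.hasFDerivAt.restrictScalars ℝ).hasFDerivWithinAt.congr_fderiv ?_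
    ext
    simp [mul_comm]
  have hinj : InjOn Φ S := by
    intro ζ hζ ξ hξ hEq
    have h1 : Complex.exp ζ = Complex.exp ξ := mul_left_cancel₀ hc (add_left_cancel hEq)
    exact Complex.exp_inj_of_neg_pi_lt_of_le_pi hζ.2.1 hζ.2.2 hξ.2.1 hξ.2.2 h1
  have key := lintegral_image_eq_lintegral_abs_det_fderiv_mul volume hSm hd hinj g
  have himg : Φ '' S ⊆ Metric.ball 0 1 := by
    rintro _ ⟨ζ, hζ, rfl⟩
    have := logPolar_mem_ball h (show ζ.re ≤ 0 from hζ.1) ζ.im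
    rwa [logPolar, Complex.re_add_im] at this
  calc ∫⁻ p, ENNReal.ofReal (‖c * Complex.exp (p.1 + p.2 * Complex.I)‖ ^ 2) *
        g (logPolar z₀ c p.1 p.2) ∂stripVolume
      = ∫⁻ p in Ω, ENNReal.ofReal (‖c * Complex.exp (p.1 + p.2 * Complex.I)‖ ^ 2) *
        g (logPolar z₀ c p.1 p.2) := by
        rw [stripVolume, Measure.prod_restrict]
        rfl
    _ = ∫⁻ ζ in S, ENNReal.ofReal (‖c * Complex.exp ζ‖ ^ 2) * g (Φ ζ) := by
        rw [← Complex.volume_preserving_equiv_real_prod.setLIntegral_comp_preimage_emb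
          Complex.measurableEquivRealProd.measurableEmbedding]
        simp only [Complex.measurableEquivRealProd_apply, logPolar, Complex.re_add_im, hΦ, hS]
    _ = ∫⁻ z in Φ '' S, g z := by
        rw [key]
        refine lintegral_congr fun ζ => ?_
        rw [det_smul_one, abs_of_nonneg (by positivity)]
    _ ≤ _ := lintegral_mono_set himg

lemma real_linear_apply {n : ℕ} (L : ℂ →L[ℝ] Fin n → ℂ) (l : ℂ) :
    L l = (l.re : ℂ) • L 1 + (l.im : ℂ) • L Complex.I := by
  have h : l = l.re • (1 : ℂ) + l.im • Complex.I := by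
    simp [Complex.re_add_im]
  conv_lhs => rw [h]
  simp only [map_add, map_smul, Complex.coe_smul]

lemma residual_le {n : ℕ} (L : ℂ →L[ℝ] Fin n → ℂ) {ε : ℝ} (hε : 0 ≤ ε) (hε' : ε ≤ 1 / 2)
    (h : ‖L 1 + Complex.I • L Complex.I‖ ≤ ε * ‖L Complex.I‖) (l : ℂ) :
    ‖L l + Complex.I • L (Complex.I * l)‖ ≤ 4 * ε * ‖L (Complex.I * l)‖ := by
  set X := L l with hX
  set Y := L (Complex.I * l) with hY
  have eX : X = (l.re : ℂ) • L 1 + (l.im : ℂ) • L Complex.I := real_linear_apply L l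
  have eY : Y = (-l.im : ℂ) • L 1 + (l.re : ℂ) • L Complex.I := by
    rw [hY, real_linear_apply]
    simp
  have e1 : X + Complex.I • Y = (starRingEnd ℂ l) • (L 1 + Complex.I • L Complex.I) := by
    rw [eX, eY]
    ext i
    simp only [Pi.add_apply, Pi.smul_apply, smul_eq_mul]
    have hl : starRingEnd ℂ l = l.re - l.im * Complex.I := by
      apply Complex.ext <;> simp
    rw [hl]
    linear_combination (l.im * L Complex.I i) * Complex.I_sq
  have e2 : ((‖l‖ ^ 2 : ℝ) : ℂ) • L Complex.I = (l.re : ℂ) • Y + (l.im : ℂ) • X := by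
    rw [eX, eY, ← Complex.normSq_eq_norm_sq, Complex.normSq_apply]
    ext i
    simp only [Pi.add_apply, Pi.smul_apply, smul_eq_mul]
    push_cast
    ring
  have h1 : ‖l‖ * ‖L Complex.I‖ ≤ ‖X‖ + ‖Y‖ := by
    rcases eq_or_ne l 0 with rfl | hl
    · simp only [norm_zero, zero_mul]; positivity
    have hl' := norm_pos_iff.2 hl
    have h2 := congrArg norm e2
    rw [norm_smul, Complex.norm_real, Real.norm_of_nonneg (by positivity)] at h2
    have h3 := norm_add_le ((l.re : ℂ) • Y) ((l.im : ℂ) • X)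
    rw [← h2, norm_smul, norm_smul, Complex.norm_real, Complex.norm_real, Real.norm_eq_abs,
      Real.norm_eq_abs] at h3
    have h4 := mul_le_mul_of_nonneg_right (Complex.abs_re_le_norm l) (norm_nonneg Y)
    have h5 := mul_le_mul_of_nonneg_right (Complex.abs_im_le_norm l) (norm_nonneg X)
    have h6 : ‖l‖ * (‖l‖ * ‖L Complex.I‖) ≤ ‖l‖ * (‖X‖ + ‖Y‖) := by nlinarith
    exact le_of_mul_le_mul_left h6 hl'
  have h2 : ‖X + Complex.I • Y‖ ≤ ε * (‖X‖ + ‖Y‖) := by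
    rw [e1, norm_smul, RCLike.norm_conj]
    calc ‖l‖ * ‖L 1 + Complex.I • L Complex.I‖ ≤ ‖l‖ * (ε * ‖L Complex.I‖) := by gcongr
      _ = ε * (‖l‖ * ‖L Complex.I‖) := by ring
      _ ≤ _ := by gcongr
  have h3 : ‖X‖ ≤ ‖X + Complex.I • Y‖ + ‖Y‖ := by
    have := norm_sub_le (X + Complex.I • Y) (Complex.I • Y)
    rwa [add_sub_cancel_right, norm_smul, Complex.norm_I, one_mul] at this
  nlinarith [norm_nonneg Y, norm_nonneg (X + Complex.I • Y)]

namespace IsDiskMap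

variable {n : ℕ} {v : ℂ → Fin n → ℂ} {M ε : ℝ}

lemma measurable_fderiv_logPolar (v : ℂ → Fin n → ℂ) (z₀ c : ℂ) (j : Fin n) {l : ℝ × ℝ → ℂ}
    (hl : Measurable l) :
    Measurable fun p : ℝ × ℝ => fderiv ℝ v (logPolar z₀ c p.1 p.2) (l p) j := by
  have hP : Measurable fun p : ℝ × ℝ => logPolar z₀ c p.1 p.2 :=
    (continuous_logPolar z₀ c).measurable
  have h1 : ∀ y : ℂ, Measurable fun p : ℝ × ℝ => fderiv ℝ v (logPolar z₀ c p.1 p.2) y j :=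
    fun y => (measurable_pi_apply j).comp ((measurable_fderiv_apply_const ℝ v y).comp hP)
  have h2 : (fun p : ℝ × ℝ => fderiv ℝ v (logPolar z₀ c p.1 p.2) (l p) j) = fun p =>
      ((l p).re : ℂ) * fderiv ℝ v (logPolar z₀ c p.1 p.2) 1 j +
        ((l p).im : ℂ) * fderiv ℝ v (logPolar z₀ c p.1 p.2) Complex.I j := by
    funext p
    rw [real_linear_apply]
    rfl
  rw [h2]
  have := h1 1
  have := h1 Complex.I
  fun_prop

lemma energy_logPolar (hv : IsDiskMap v M ε) {z₀ c : ℂ} (h : ‖z₀‖ + ‖c‖ < 1) (hc : c ≠ 0)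
    (j : Fin n) {l : ℝ × ℝ → ℂ}
    (hl : ∀ p : ℝ × ℝ, ‖l p‖ = ‖c * Complex.exp (p.1 + p.2 * Complex.I)‖) :
    ∫⁻ p, ‖fderiv ℝ v (logPolar z₀ c p.1 p.2) (l p) j‖ₑ ^ 2 ∂stripVolume < ⊤ := by
  refine lt_of_le_of_lt (lintegral_mono fun p => ?_)
    ((lintegral_logPolar_le h hc fun z => ‖fderiv ℝ v z‖ₑ ^ 2).trans_lt hv.energy)
  rw [← hl p]
  have h1 : ‖fderiv ℝ v (logPolar z₀ c p.1 p.2) (l p) j‖ ≤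
      ‖l p‖ * ‖fderiv ℝ v (logPolar z₀ c p.1 p.2)‖ :=
    (norm_le_pi_norm _ j).trans ((ContinuousLinearMap.le_opNorm _ _).trans_eq (mul_comm _ _))
  calc ‖fderiv ℝ v (logPolar z₀ c p.1 p.2) (l p) j‖ₑ ^ 2
      = ENNReal.ofReal (‖fderiv ℝ v (logPolar z₀ c p.1 p.2) (l p) j‖ ^ 2) :=
        enorm_sq_eq_ofReal _
    _ ≤ ENNReal.ofReal (‖l p‖ ^ 2 * ‖fderiv ℝ v (logPolar z₀ c p.1 p.2)‖ ^ 2) := by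
        rw [← mul_pow]
        gcongr
    _ = _ := by
        rw [ENNReal.ofReal_mul (by positivity), ENNReal.ofReal_pow (norm_nonneg (fderiv ℝ v _)),
          ofReal_norm]

/-- A disk map in logarithmic polar coordinates is a strip function. -/
lemma isStripFunction (hv : IsDiskMap v M ε) {z₀ c : ℂ} (h : ‖z₀‖ + ‖c‖ < 1) (hc : c ≠ 0)
    (j : Fin n) :
    IsStripFunction (fun s θ => v (logPolar z₀ c s θ) j)
      (fun s θ => fderiv ℝ v (logPolar z₀ c s θ) (c * Complex.exp (s + θ * Complex.I)) j)
      (fun s θ => fderiv ℝ v (logPolar z₀ c s θ)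
        (Complex.I * (c * Complex.exp (s + θ * Complex.I))) j) M where
  cont := (continuous_apply j).comp_continuousOn (hv.cont.comp
    (continuous_logPolar z₀ c).continuousOn fun p hp =>
      Metric.ball_subset_closedBall (logPolar_mem_ball h hp.1 p.2))
  bound s hs θ := (norm_le_pi_norm _ j).trans
    (hv.bound _ (Metric.ball_subset_closedBall (logPolar_mem_ball h hs θ)))
  periodic s _ := by
    simp [logPolar_eq, Complex.exp_neg]
  meas_s := measurable_fderiv_logPolar v z₀ c j
    (l := fun p => c * Complex.exp (p.1 + p.2 * Complex.I)) (by fun_prop)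
  meas_θ := measurable_fderiv_logPolar v z₀ c j
    (l := fun p => Complex.I * (c * Complex.exp (p.1 + p.2 * Complex.I))) (by fun_prop)
  deriv_θ s hs := by
    refine ⟨_, countable_logPolar_im z₀ hc s, fun θ hθ => ?_⟩
    have h1 := (hv.diff _ (logPolar_mem_ball h hs θ) hθ).hasFDerivAt
    exact hasDerivAt_pi.1 (h1.comp_hasDerivAt θ (hasDerivAt_logPolar_right z₀ c s θ)) j
  deriv_s := by
    filter_upwards [ae_countable_logPolar_im z₀ hc] with θ hN
    refine ⟨_, hN, fun s hs hsN => ?_⟩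
    have h1 := (hv.diff _ (logPolar_mem_ball h hs.le θ) hsN).hasFDerivAt
    exact hasDerivAt_pi.1 (h1.comp_hasDerivAt s (hasDerivAt_logPolar_left z₀ c s θ)) j
  energy_s := hv.energy_logPolar h hc j
    (l := fun p => c * Complex.exp (p.1 + p.2 * Complex.I)) fun _ => rfl
  energy_θ := hv.energy_logPolar h hc j
    (l := fun p => Complex.I * (c * Complex.exp (p.1 + p.2 * Complex.I))) fun p => by
      rw [norm_mul, Complex.norm_I, one_mul]

lemma residual_logPolar (hv : IsDiskMap v M ε) (hε : 0 ≤ ε) (hε' : ε ≤ 1 / 2) {z₀ c : ℂ}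
    (h : ‖z₀‖ + ‖c‖ < 1) (hc : c ≠ 0) {s : ℝ} (hs : s ≤ 0) :
    ∀ᵐ θ : ℝ, ∀ j, ‖fderiv ℝ v (logPolar z₀ c s θ) (c * Complex.exp (s + θ * Complex.I)) j +
        Complex.I * fderiv ℝ v (logPolar z₀ c s θ)
          (Complex.I * (c * Complex.exp (s + θ * Complex.I))) j‖ₑ ^ 2 ≤
      ENNReal.ofReal ((4 * ε) ^ 2) * ∑ i, ‖fderiv ℝ v (logPolar z₀ c s θ)
        (Complex.I * (c * Complex.exp (s + θ * Complex.I))) i‖ₑ ^ 2 := by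
  filter_upwards [(countable_logPolar_im z₀ hc s).ae_notMem volume] with θ hθ j
  set L := fderiv ℝ v (logPolar z₀ c s θ)
  set l := c * Complex.exp (s + θ * Complex.I)
  have h1 := residual_le L hε hε' (hv.residual _ (logPolar_mem_ball h hs θ) hθ) l
  have h2 := (norm_le_pi_norm (L l + Complex.I • L (Complex.I * l)) j).trans h1
  have : Nonempty (Fin n) := ⟨j⟩
  obtain ⟨i, hi⟩ := Finite.exists_max fun i => ‖L (Complex.I * l) i‖
  have h3 : ‖L (Complex.I * l)‖ ≤ ‖L (Complex.I * l) i‖ :=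
    (pi_norm_le_iff_of_nonempty _).2 hi
  calc ‖L l j + Complex.I * L (Complex.I * l) j‖ₑ ^ 2
      = ENNReal.ofReal (‖L l j + Complex.I * L (Complex.I * l) j‖ ^ 2) := enorm_sq_eq_ofReal _
    _ ≤ ENNReal.ofReal ((4 * ε * ‖L (Complex.I * l) i‖) ^ 2) := by
        gcongr
        exact h2.trans (by gcongr)
    _ = ENNReal.ofReal ((4 * ε) ^ 2) * ‖L (Complex.I * l) i‖ₑ ^ 2 := by
        rw [mul_pow, ENNReal.ofReal_mul (by positivity), enorm_sq_eq_ofReal]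
    _ ≤ _ := by
        gcongr
        exact Finset.single_le_sum (f := fun i => ‖L (Complex.I * l) i‖ₑ ^ 2)
          (fun _ _ => zero_le) (Finset.mem_univ i)

end IsDiskMap

/-- Componentwise complex conjugation. -/
noncomputable def conjPi (n : ℕ) : (Fin n → ℂ) →L[ℝ] (Fin n → ℂ) :=
  ContinuousLinearMap.pi fun i => Complex.conjCLE.toContinuousLinearMap.comp
    (ContinuousLinearMap.proj i)

lemma conjPi_apply {n : ℕ} (w : Fin n → ℂ) (i : Fin n) :
    conjPi n w i = starRingEnd ℂ (w i) := rfl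

lemma norm_conjPi {n : ℕ} (w : Fin n → ℂ) : ‖conjPi n w‖ = ‖w‖ := by
  simp only [Pi.norm_def, conjPi_apply]
  congr 2
  funext i
  exact NNReal.eq (RCLike.norm_conj _)

open Classical in
/-- The Schwarz reflection of a map across the real line. -/
noncomputable def schwarzReflection {n : ℕ} (u : ℂ → Fin n → ℂ) (z : ℂ) : Fin n → ℂ :=
  if 0 ≤ z.im then u z else conjPi n (u (starRingEnd ℂ z))

section Reflection

variable {n : ℕ} {u : ℂ → Fin n → ℂ}

lemma schwarzReflection_of_nonneg {z : ℂ} (hz : 0 ≤ z.im) : schwarzReflection u z = u z :=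
  if_pos hz

lemma schwarzReflection_of_neg {z : ℂ} (hz : z.im < 0) :
    schwarzReflection u z = conjPi n (u (starRingEnd ℂ z)) :=
  if_neg hz.not_ge

lemma continuousOn_schwarzReflection (hu : ContinuousOn u (closedHalfDisk 1))
    (hb : ∀ z ∈ closedHalfDisk 1, z.im = 0 → u z ∈ realSlice n) :
    ContinuousOn (schwarzReflection u) (Metric.closedBall 0 1) := by
  have hlow : ∀ z : ℂ, z ∈ Metric.closedBall 0 1 ∩ {z : ℂ | z.im ≤ 0} →
      schwarzReflection u z = conjPi n (u (starRingEnd ℂ z)) := by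
    rintro z ⟨hz, hz0⟩
    rcases lt_or_eq_of_le (show z.im ≤ 0 from hz0) with h | h
    · exact schwarzReflection_of_neg h
    · rw [schwarzReflection_of_nonneg h.ge, Complex.conj_eq_iff_im.2 h]
      have hr := hb z ⟨mem_closedBall_zero_iff.1 hz, h.ge⟩ h
      funext i
      rw [conjPi_apply, Complex.conj_eq_iff_im.2 (hr i)]
  have h1 : ContinuousOn (schwarzReflection u) (Metric.closedBall 0 1 ∩ {z : ℂ | 0 ≤ z.im}) :=
    (hu.mono fun z hz => ⟨mem_closedBall_zero_iff.1 hz.1, hz.2⟩).congr fun z hz =>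
      schwarzReflection_of_nonneg hz.2
  have h2 : ContinuousOn (schwarzReflection u) (Metric.closedBall 0 1 ∩ {z : ℂ | z.im ≤ 0}) := by
    refine ContinuousOn.congr ?_ hlow
    refine (conjPi n).continuous.comp_continuousOn (hu.comp
      Complex.continuous_conj.continuousOn fun z hz => ⟨?_, ?_⟩)
    · rw [RCLike.norm_conj]
      exact mem_closedBall_zero_iff.1 hz.1
    · simpa using hz.2
  have h3 := h1.union_of_isClosed h2
    (Metric.isClosed_closedBall.inter (isClosed_le continuous_const Complex.continuous_im))
    (Metric.isClosed_closedBall.inter (isClosed_le Complex.continuous_im continuous_const))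
  refine h3.mono fun z hz => ?_
  rcases le_total 0 z.im with h | h
  · exact Or.inl ⟨hz, h⟩
  · exact Or.inr ⟨hz, h⟩

lemma norm_schwarzReflection_le {M : ℝ} (hM : ∀ z ∈ closedHalfDisk 1, ‖u z‖ ≤ M) {z : ℂ}
    (hz : z ∈ Metric.closedBall (0 : ℂ) 1) : ‖schwarzReflection u z‖ ≤ M := by
  rw [mem_closedBall_zero_iff] at hz
  rcases le_or_gt 0 z.im with h | h
  · rw [schwarzReflection_of_nonneg h]
    exact hM z ⟨hz, h⟩
  · rw [schwarzReflection_of_neg h, norm_conjPi]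
    exact hM _ ⟨by rwa [RCLike.norm_conj], by simpa using h.le⟩

lemma hasFDerivAt_schwarzReflection_of_pos {z : ℂ} (hz : 0 < z.im)
    (hd : DifferentiableAt ℝ u z) : HasFDerivAt (schwarzReflection u) (fderiv ℝ u z) z := by
  refine hd.hasFDerivAt.congr_of_eventuallyEq ?_
  filter_upwards [Complex.continuous_im.continuousAt.eventually (lt_mem_nhds hz)] with w hw
  exact schwarzReflection_of_nonneg hw.le

lemma hasFDerivAt_schwarzReflection_of_neg {z : ℂ} (hz : z.im < 0)
    (hd : DifferentiableAt ℝ u (starRingEnd ℂ z)) :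
    HasFDerivAt (schwarzReflection u) ((conjPi n).comp ((fderiv ℝ u (starRingEnd ℂ z)).comp
      Complex.conjCLE.toContinuousLinearMap)) z := by
  have h1 : HasFDerivAt (fun w : ℂ => u (starRingEnd ℂ w))
      ((fderiv ℝ u (starRingEnd ℂ z)).comp Complex.conjCLE.toContinuousLinearMap) z :=
    HasFDerivAt.comp (g := u) z hd.hasFDerivAt Complex.conjCLE.toContinuousLinearMap.hasFDerivAt
  refine ((conjPi n).hasFDerivAt.comp z h1).congr_of_eventuallyEq ?_
  filter_upwards [Complex.continuous_im.continuousAt.eventually (gt_mem_nhds hz)] with w hw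
  exact schwarzReflection_of_neg hw

lemma conj_mem_halfDisk {z : ℂ} (hz : z ∈ Metric.ball (0 : ℂ) 1) (h : z.im < 0) :
    starRingEnd ℂ z ∈ halfDisk :=
  ⟨by rw [RCLike.norm_conj]; exact mem_ball_zero_iff.1 hz, by simpa using h⟩

lemma differentiableAt_schwarzReflection (hd : ∀ z ∈ halfDisk, DifferentiableAt ℝ u z) {z : ℂ}
    (hz : z ∈ Metric.ball (0 : ℂ) 1) (h : z.im ≠ 0) :
    DifferentiableAt ℝ (schwarzReflection u) z := by
  rcases h.lt_or_gt with h | h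
  · exact (hasFDerivAt_schwarzReflection_of_neg h
      (hd _ (conj_mem_halfDisk hz h))).differentiableAt
  · exact (hasFDerivAt_schwarzReflection_of_pos h
      (hd z ⟨mem_ball_zero_iff.1 hz, h⟩)).differentiableAt

lemma norm_residual_le {ε : ℝ} {J : (Fin n → ℂ) →L[ℝ] (Fin n → ℂ)} (hJ : ‖J - Jstd n‖ ≤ ε)
    {X Y : Fin n → ℂ} (h : X + J Y = 0) : ‖X + Complex.I • Y‖ ≤ ε * ‖Y‖ := by
  have h1 : X + Complex.I • Y = -((J - Jstd n) Y) := by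
    rw [sub_apply, eq_neg_of_add_eq_zero_left h]
    change _ = -(J Y - Complex.I • Y)
    abel
  rw [h1, norm_neg]
  exact ((J - Jstd n).le_opNorm Y).trans (by gcongr)

lemma residual_schwarzReflection {ε : ℝ} {J : (Fin n → ℂ) → ((Fin n → ℂ) →L[ℝ] (Fin n → ℂ))}
    (hJ : ∀ x, ‖J x - Jstd n‖ ≤ ε) (hd : ∀ z ∈ halfDisk, DifferentiableAt ℝ u z)
    (hu : ∀ z ∈ halfDisk, fderiv ℝ u z 1 + J (u z) (fderiv ℝ u z Complex.I) = 0) {z : ℂ}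
    (hz : z ∈ Metric.ball (0 : ℂ) 1) (h : z.im ≠ 0) :
    ‖fderiv ℝ (schwarzReflection u) z 1 + Complex.I • fderiv ℝ (schwarzReflection u) z Complex.I‖
      ≤ ε * ‖fderiv ℝ (schwarzReflection u) z Complex.I‖ := by
  rcases h.lt_or_gt with h | h
  · have hz' := conj_mem_halfDisk hz h
    rw [(hasFDerivAt_schwarzReflection_of_neg h (hd _ hz')).fderiv]
    have h1 := norm_residual_le (hJ _) (hu _ hz')
    set L := fderiv ℝ u (starRingEnd ℂ z)
    have e1 : ((conjPi n).comp (L.comp Complex.conjCLE.toContinuousLinearMap)) 1 =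
        conjPi n (L 1) := by simp
    have e2 : ((conjPi n).comp (L.comp Complex.conjCLE.toContinuousLinearMap)) Complex.I =
        -conjPi n (L Complex.I) := by simp
    have e3 : conjPi n (L 1) + Complex.I • -conjPi n (L Complex.I) =
        conjPi n (L 1 + Complex.I • L Complex.I) := by
      funext i
      simp [conjPi_apply]
    rwa [e1, e2, e3, norm_neg, norm_conjPi, norm_conjPi]
  · have hz' : z ∈ halfDisk := ⟨mem_ball_zero_iff.1 hz, h⟩
    rw [(hasFDerivAt_schwarzReflection_of_pos h (hd z hz')).fderiv]
    exact norm_residual_le (hJ _) (hu z hz')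

lemma norm_conjPi_comp_le (L : ℂ →L[ℝ] Fin n → ℂ) :
    ‖(conjPi n).comp (L.comp Complex.conjCLE.toContinuousLinearMap)‖ ≤ ‖L‖ := by
  refine ContinuousLinearMap.opNorm_le_bound _ (norm_nonneg _) fun l => ?_
  change ‖conjPi n (L (starRingEnd ℂ l))‖ ≤ _
  rw [norm_conjPi, ← RCLike.norm_conj l]
  exact L.le_opNorm _

lemma norm_le_add_norm_apply (L : ℂ →L[ℝ] Fin n → ℂ) : ‖L‖ ≤ ‖L 1‖ + ‖L Complex.I‖ := by
  refine ContinuousLinearMap.opNorm_le_bound _ (by positivity) fun l => ?_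
  rw [real_linear_apply L l]
  refine (norm_add_le _ _).trans ?_
  rw [norm_smul, norm_smul, Complex.norm_real, Complex.norm_real, Real.norm_eq_abs,
    Real.norm_eq_abs, add_mul, mul_comm ‖L 1‖, mul_comm ‖L Complex.I‖]
  gcongr
  · exact Complex.abs_re_le_norm l
  · exact Complex.abs_im_le_norm l

lemma energy_halfDisk (hE : IntegrableOn
    (fun z => ‖fderiv ℝ u z 1‖ ^ 2 + ‖fderiv ℝ u z Complex.I‖ ^ 2) halfDisk) :
    ∫⁻ z in halfDisk, ‖fderiv ℝ u z‖ₑ ^ 2 < ⊤ := by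
  have h1 := (hE.const_mul 2).lintegral_lt_top
  refine lt_of_le_of_lt (lintegral_mono fun z => ?_) h1
  rw [← ofReal_norm, ← ENNReal.ofReal_pow (norm_nonneg _)]
  refine ENNReal.ofReal_le_ofReal ?_
  have h2 := norm_le_add_norm_apply (fderiv ℝ u z)
  nlinarith [norm_nonneg (fderiv ℝ u z), sq_nonneg (‖fderiv ℝ u z 1‖ - ‖fderiv ℝ u z Complex.I‖)]

lemma volume_im_eq_zero : volume {z : ℂ | z.im = 0} = 0 := by
  have h : {z : ℂ | z.im = 0} = Complex.measurableEquivRealProd ⁻¹' (univ ×ˢ {0}) := by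
    ext z
    simp [Complex.measurableEquivRealProd_apply]
  rw [h, Complex.volume_preserving_equiv_real_prod.measure_preimage_equiv, Measure.volume_eq_prod,
    Measure.prod_prod]
  simp

lemma measurableSet_halfDisk : MeasurableSet halfDisk :=
  ((isOpen_lt continuous_norm continuous_const).inter
    (isOpen_lt continuous_const Complex.continuous_im)).measurableSet

lemma energy_schwarzReflection (hd : ∀ z ∈ halfDisk, DifferentiableAt ℝ u z)
    (hE : IntegrableOn
      (fun z => ‖fderiv ℝ u z 1‖ ^ 2 + ‖fderiv ℝ u z Complex.I‖ ^ 2) halfDisk) :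
    ∫⁻ z in Metric.ball (0 : ℂ) 1, ‖fderiv ℝ (schwarzReflection u) z‖ₑ ^ 2 < ⊤ := by
  have hE' := energy_halfDisk hE
  set g : ℂ → ENNReal := fun z => ‖fderiv ℝ (schwarzReflection u) z‖ₑ ^ 2 with hg
  set e : ℂ ≃ᵐ ℂ := Complex.conjLIE.toHomeomorph.toMeasurableEquiv with he
  have hsub : Metric.ball (0 : ℂ) 1 ⊆
      ({z : ℂ | z.im = 0} ∪ halfDisk) ∪ e ⁻¹' halfDisk := by
    intro z hz
    rcases lt_trichotomy z.im 0 with h | h | h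
    · exact Or.inr (conj_mem_halfDisk hz h)
    · exact Or.inl (Or.inl h)
    · exact Or.inl (Or.inr ⟨mem_ball_zero_iff.1 hz, h⟩)
  have h0 : ∫⁻ z in {z : ℂ | z.im = 0}, g z = 0 :=
    setLIntegral_measure_zero _ _ volume_im_eq_zero
  have h1 : ∫⁻ z in halfDisk, g z = ∫⁻ z in halfDisk, ‖fderiv ℝ u z‖ₑ ^ 2 :=
    setLIntegral_congr_fun measurableSet_halfDisk fun z hz => by
      simp only [hg, (hasFDerivAt_schwarzReflection_of_pos hz.2 (hd z hz)).fderiv]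
  have h2 : ∫⁻ z in e ⁻¹' halfDisk, g z ≤ ∫⁻ z in halfDisk, ‖fderiv ℝ u z‖ₑ ^ 2 := by
    have hmp : MeasurePreserving e volume volume := Complex.conjLIE.measurePreserving
    rw [← hmp.setLIntegral_comp_preimage_emb e.measurableEmbedding _ halfDisk]
    refine setLIntegral_mono' (e.measurable measurableSet_halfDisk) fun z hz => ?_
    have hz' : starRingEnd ℂ z ∈ halfDisk := hz
    have hneg : z.im < 0 := by simpa using hz'.2
    simp only [hg, (hasFDerivAt_schwarzReflection_of_neg hneg (hd _ hz')).fderiv]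
    rw [← ofReal_norm, ← ofReal_norm]
    gcongr
    exact norm_conjPi_comp_le _
  calc ∫⁻ z in Metric.ball (0 : ℂ) 1, g z
      ≤ ∫⁻ z in ({z : ℂ | z.im = 0} ∪ halfDisk) ∪ e ⁻¹' halfDisk, g z := lintegral_mono_set hsub
    _ ≤ ((∫⁻ z in {z : ℂ | z.im = 0}, g z) + ∫⁻ z in halfDisk, g z) +
        ∫⁻ z in e ⁻¹' halfDisk, g z :=
        (lintegral_union_le _ _ _).trans (by gcongr; exact lintegral_union_le _ _ _)
    _ < ⊤ := by
        rw [h0, h1, zero_add]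
        exact ENNReal.add_lt_top.2 ⟨hE', h2.trans_lt hE'⟩

/-- The Schwarz reflection of a `J`-holomorphic half-disk with real boundary values. -/
lemma isDiskMap_schwarzReflection {M ε : ℝ}
    {J : (Fin n → ℂ) → ((Fin n → ℂ) →L[ℝ] (Fin n → ℂ))} (hJ : ∀ x, ‖J x - Jstd n‖ ≤ ε)
    (hcont : ContinuousOn u (closedHalfDisk 1)) (hM : ∀ z ∈ closedHalfDisk 1, ‖u z‖ ≤ M)
    (hd : ∀ z ∈ halfDisk, DifferentiableAt ℝ u z)
    (hu : ∀ z ∈ halfDisk, fderiv ℝ u z 1 + J (u z) (fderiv ℝ u z Complex.I) = 0)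
    (hE : IntegrableOn
      (fun z => ‖fderiv ℝ u z 1‖ ^ 2 + ‖fderiv ℝ u z Complex.I‖ ^ 2) halfDisk)
    (hb : ∀ z ∈ closedHalfDisk 1, z.im = 0 → u z ∈ realSlice n) :
    IsDiskMap (schwarzReflection u) M ε where
  cont := continuousOn_schwarzReflection hcont hb
  bound _ := norm_schwarzReflection_le hM
  diff _ := differentiableAt_schwarzReflection hd
  residual _ := residual_schwarzReflection hJ hd hu
  energy := energy_schwarzReflection hd hE

end Reflection

/-- Two logarithmic polar rays issued from `z₀` and `z₁` at opposite angles meet on the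
perpendicular bisector of the segment joining these points. -/
lemma logPolar_meet {z₀ z₁ : ℂ} {ρ φ : ℝ} (hρ : ρ ≠ 0) (hz : z₀ ≠ z₁) (hφ : 0 < Real.cos φ) {s : ℝ}
    (hs : Real.exp s = ‖z₁ - z₀‖ / (2 * ρ * Real.cos φ)) :
    logPolar z₀ (ρ / ‖z₁ - z₀‖ * (z₁ - z₀)) s φ =
      logPolar z₁ (-(ρ / ‖z₁ - z₀‖ * (z₁ - z₀))) s (-φ) := by
  have hd : (‖z₁ - z₀‖ : ℂ) ≠ 0 :=
    Complex.ofReal_ne_zero.2 (norm_ne_zero_iff.2 (sub_ne_zero.2 hz.symm))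
  have hρ' : (ρ : ℂ) ≠ 0 := Complex.ofReal_ne_zero.2 hρ
  have hφ' : Complex.cos φ ≠ 0 := by
    rw [← Complex.ofReal_cos]
    exact Complex.ofReal_ne_zero.2 hφ.ne'
  have h1 := Complex.two_cos (φ : ℂ)
  rw [logPolar_eq, logPolar_eq, hs]
  push_cast
  rw [← sub_eq_zero]
  have e : z₀ + ρ / ‖z₁ - z₀‖ * (z₁ - z₀) * (‖z₁ - z₀‖ / (2 * ρ * Complex.cos φ) *
      Complex.exp (φ * Complex.I)) - (z₁ + -(ρ / ‖z₁ - z₀‖ * (z₁ - z₀)) *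
      (‖z₁ - z₀‖ / (2 * ρ * Complex.cos φ) * Complex.exp (-φ * Complex.I))) =
      (z₁ - z₀) * (Complex.exp (φ * Complex.I) + Complex.exp (-φ * Complex.I)) /
        (2 * Complex.cos φ) - (z₁ - z₀) := by
    field_simp
    ring
  rw [e, ← h1, mul_div_cancel_right₀ _ (mul_ne_zero two_ne_zero hφ'), sub_self]

lemma sqrt_two_div_two_le_cos {φ : ℝ} (hφ : φ ∈ Icc (-(Real.pi / 4)) (Real.pi / 4)) :
    Real.sqrt 2 / 2 ≤ Real.cos φ := by
  rw [← Real.cos_pi_div_four, ← Real.cos_abs φ]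
  exact Real.cos_le_cos_of_nonneg_of_le_pi (abs_nonneg _) (by linarith [Real.pi_pos])
    (abs_le.2 hφ)

/-- The constant in the interior Hölder estimate for disk maps. -/
noncomputable def diskConstant (n : ℕ) (α : ℝ) : ℝ :=
  Real.sqrt (4 * stripConstant n α * (2 / (α * (1 - Real.exp (-(α * Real.log 2))) ^ 2)))

lemma stripConstant_nonneg (n : ℕ) {α : ℝ} (hα : 0 < α) : 0 ≤ stripConstant n α := by
  have := Real.pi_pos
  unfold stripConstant
  positivity

namespace IsDiskMap

variable {n : ℕ} {v : ℂ → Fin n → ℂ} {M ε α ρ : ℝ}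

lemma ray_length (hv : IsDiskMap v M ε) (hε : 0 ≤ ε) (hε' : ε ≤ 1 / 2) (hα : 0 < α) (hα1 : α < 1)
    (hκ : 2 / (1 - α) ^ 2 * (n * (4 * ε) ^ 2) ≤ 1 / 2) {z₀ c : ℂ} (h : ‖z₀‖ + ‖c‖ < 1) (hc : c ≠ 0)
    (S : ℝ) {T : ℝ} (hT : T ≤ -(Real.log 2 / 2)) (j : Fin n) :
    ∫⁻ θ in Ioc (-Real.pi) Real.pi, (∫⁻ s in Ioc S T, ‖fderiv ℝ v (logPolar z₀ c s θ)
        (c * Complex.exp (s + θ * Complex.I)) j‖ₑ) ^ 2 ≤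
      ENNReal.ofReal ((diskConstant n α * (M * Real.exp (α * T))) ^ 2) := by
  have hlog := Real.log_pos one_lt_two
  have hb : 0 < 1 - Real.exp (-(α * Real.log 2)) :=
    sub_pos.2 (Real.exp_lt_one_iff.2 (neg_lt_zero.2 (mul_pos hα hlog)))
  have hTb : Real.exp (α * T) ^ 2 ≤ 1 - (1 - Real.exp (-(α * Real.log 2))) := by
    rw [sub_sub_cancel, ← Real.exp_nat_mul, Real.exp_le_exp]
    push_cast
    nlinarith
  have hst := stripConstant_nonneg n hα
  have h1 := system_estimate (fun i => hv.isStripFunction h hc i) hα hα1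
    (Real.exp_pos (α * S)) (sq_nonneg (4 * ε)) hκ
    (fun s hs => hv.residual_logPolar hε hε' h hc hs) j
  have h2 := (hv.isStripFunction h hc j).ray_length_sq_le (S := S) hα hb (by linarith) hTb
    (by positivity) h1
  refine h2.trans_eq ?_
  rw [mul_pow, diskConstant, Real.sq_sqrt (by positivity)]
  ring_nf

lemma norm_sub_apply_le (hv : IsDiskMap v M ε) (hε : 0 ≤ ε) (hε' : ε ≤ 1 / 2) (hα : 0 < α)
    (hα1 : α < 1) (hκ : 2 / (1 - α) ^ 2 * (n * (4 * ε) ^ 2) ≤ 1 / 2) (hρ : 0 < ρ) {z₀ z₁ : ℂ}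
    (h₀ : ‖z₀‖ + ρ < 1) (h₁ : ‖z₁‖ + ρ < 1) (hne : z₀ ≠ z₁) (hd : ‖z₁ - z₀‖ ≤ ρ) (j : Fin n) :
    ‖v z₀ j - v z₁ j‖ ≤ 2 * (diskConstant n α * (M * (‖z₁ - z₀‖ / ρ) ^ α)) := by
  set d := ‖z₁ - z₀‖ with hddef
  have hd0 : 0 < d := norm_pos_iff.2 (sub_ne_zero.2 hne.symm)
  have hM : 0 ≤ M := (norm_nonneg _).trans (hv.bound 0 (by simp))
  have hD : 0 ≤ diskConstant n α := Real.sqrt_nonneg _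
  have hs2 : 0 < Real.sqrt 2 := by positivity
  have hs2' : Real.sqrt 2 * Real.sqrt 2 = 2 := Real.mul_self_sqrt (by norm_num)
  set c : ℂ := ρ / d * (z₁ - z₀) with hcdef
  have hcn : ‖c‖ = ρ := by
    rw [hcdef, norm_mul, norm_div, Complex.norm_real, Complex.norm_real, Real.norm_of_nonneg hρ.le,
      Real.norm_of_nonneg hd0.le, ← hddef, div_mul_cancel₀ _ hd0.ne']
  have hc : c ≠ 0 := norm_ne_zero_iff.1 (hcn ▸ hρ.ne')
  have hH₀ : ‖z₀‖ + ‖c‖ < 1 := by rwa [hcn]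
  have hH₁ : ‖z₁‖ + ‖-c‖ < 1 := by rwa [norm_neg, hcn]
  set T := Real.log (d / (Real.sqrt 2 * ρ)) with hTdef
  have hTe : Real.exp T = d / (Real.sqrt 2 * ρ) := Real.exp_log (by positivity)
  have hT : T ≤ -(Real.log 2 / 2) := by
    rw [← Real.log_sqrt (by norm_num), ← Real.log_inv, hTdef]
    refine Real.log_le_log (by positivity) ?_
    rw [div_le_iff₀ (by positivity), inv_mul_cancel_left₀ hs2.ne']
    exact hd
  have hTα : Real.exp (α * T) ≤ (d / ρ) ^ α := by
    rw [mul_comm, Real.exp_mul, hTe]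
    refine Real.rpow_le_rpow (by positivity) ?_ hα.le
    gcongr
    nlinarith [Real.one_le_sqrt.2 one_le_two]
  have hT0 : T ≤ 0 := hT.trans (by linarith [Real.log_pos one_lt_two])
  set B := (diskConstant n α * (M * Real.exp (α * T))) ^ 2 with hB
  have hsB : Real.sqrt B ≤ diskConstant n α * (M * (d / ρ) ^ α) := by
    rw [hB, Real.sqrt_sq (by positivity)]
    gcongr
  suffices h : ∀ η > 0, ‖v z₀ j - v z₁ j‖ ≤ 2 * Real.sqrt B + 2 * η by
    have : ‖v z₀ j - v z₁ j‖ ≤ 2 * Real.sqrt B :=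
      le_of_forall_pos_le_add fun η hη => by linarith [h (η / 2) (by linarith)]
    linarith
  intro η hη
  have hsmall : ∀ z : ℂ, ‖z‖ + ρ < 1 → ∀ᶠ S in atBot, ∀ a : ℂ, ‖a‖ = ρ → ∀ θ,
      ‖v (logPolar z a S θ) j - v z j‖ ≤ η := by
    intro z hz
    have hzm : z ∈ Metric.closedBall (0 : ℂ) 1 := mem_closedBall_zero_iff.2 (by linarith)
    obtain ⟨r, hr, hrv⟩ := Metric.continuousWithinAt_iff.1 (hv.cont z hzm) η hη
    have ht : Tendsto (fun S => ρ * Real.exp S) atBot (𝓝 0) := by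
      simpa using Real.tendsto_exp_atBot.const_mul ρ
    filter_upwards [ht.eventually (gt_mem_nhds hr), eventually_le_atBot 0] with S hS hS0 a ha θ
    have h1 := hrv (Metric.ball_subset_closedBall
      (logPolar_mem_ball (show ‖z‖ + ‖a‖ < 1 by rwa [ha]) hS0 θ))
      (by rwa [dist_eq_norm, norm_logPolar_sub, ha])
    rw [dist_eq_norm] at h1
    exact (norm_le_pi_norm (v (logPolar z a S θ) - v z) j).trans h1.le
  obtain ⟨S, hS₀, hS₁, hSd⟩ := ((hsmall z₀ h₀).and ((hsmall z₁ h₁).and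
    (eventually_le_atBot (Real.log (d / (2 * ρ)))))).exists
  refine (hv.isStripFunction hH₀ hc j).norm_sub_le_of_meet
    (hv.isStripFunction hH₁ (neg_ne_zero.2 hc) j) hT0 (sq_nonneg _)
    (hv.ray_length hε hε' hα hα1 hκ hH₀ hc S hT j)
    (hv.ray_length hε hε' hα hα1 hκ hH₁ (neg_ne_zero.2 hc) S hT j)
    (hS₀ c hcn) (hS₁ (-c) (by rw [norm_neg, hcn])) fun φ hφ => ?_
  have hcos := sqrt_two_div_two_le_cos hφ
  have hcos0 : 0 < Real.cos φ := lt_of_lt_of_le (by positivity) hcos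
  have hpos : 0 < d / (2 * ρ * Real.cos φ) := by positivity
  refine ⟨Real.log (d / (2 * ρ * Real.cos φ)), ⟨?_, ?_⟩, ?_⟩
  · refine hSd.trans (Real.log_le_log (by positivity) ?_)
    refine div_le_div_of_nonneg_left hd0.le (by positivity) ?_
    exact mul_le_of_le_one_right (by positivity) (Real.cos_le_one φ)
  · refine Real.log_le_log hpos ?_
    refine div_le_div_of_nonneg_left hd0.le (by positivity) ?_
    nlinarith [mul_le_mul_of_nonneg_left hcos hρ.le]
  · exact congrFun (congrArg v (logPolar_meet hρ.ne' hne hcos0 (Real.exp_log hpos))) j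

/-- Interior Hölder estimate for disk maps. -/
lemma norm_sub_le (hv : IsDiskMap v M ε) (hε : 0 ≤ ε) (hε' : ε ≤ 1 / 2) (hα : 0 < α)
    (hα1 : α < 1) (hκ : 2 / (1 - α) ^ 2 * (n * (4 * ε) ^ 2) ≤ 1 / 2) (hρ : 0 < ρ) {z₀ z₁ : ℂ}
    (h₀ : ‖z₀‖ + ρ < 1) (h₁ : ‖z₁‖ + ρ < 1) :
    ‖v z₀ - v z₁‖ ≤ 2 * (diskConstant n α + 1) / ρ ^ α * M * ‖z₀ - z₁‖ ^ α := by
  have hM : 0 ≤ M := (norm_nonneg _).trans (hv.bound 0 (by simp))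
  have hD : 0 ≤ diskConstant n α := Real.sqrt_nonneg _
  have hform : 2 * (diskConstant n α + 1) / ρ ^ α * M * ‖z₀ - z₁‖ ^ α =
      2 * ((diskConstant n α + 1) * (M * (‖z₁ - z₀‖ / ρ) ^ α)) := by
    rw [Real.div_rpow (norm_nonneg _) hρ.le, norm_sub_rev]
    ring
  rw [hform]
  rcases eq_or_ne z₀ z₁ with rfl | hne
  · rw [sub_self, norm_zero]
    positivity
  rcases le_or_gt ‖z₁ - z₀‖ ρ with hd | hd
  · refine (pi_norm_le_iff_of_nonneg (by positivity)).2 fun j => ?_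
    refine (hv.norm_sub_apply_le hε hε' hα hα1 hκ hρ h₀ h₁ hne hd j).trans ?_
    gcongr
    linarith
  · have h2 : 1 ≤ (‖z₁ - z₀‖ / ρ) ^ α :=
      Real.one_le_rpow ((one_le_div hρ).2 hd.le) hα.le
    have h3 := _root_.norm_sub_le (v z₀) (v z₁)
    have h4 := hv.bound z₀ (mem_closedBall_zero_iff.2 (by linarith))
    have h5 := hv.bound z₁ (mem_closedBall_zero_iff.2 (by linarith))
    have h6 : 1 * (M * 1) ≤ (diskConstant n α + 1) * (M * (‖z₁ - z₀‖ / ρ) ^ α) := by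
      gcongr
      linarith
    linarith

end IsDiskMap

/-- A deviation from the standard structure that is small enough for the Hölder estimate. -/
lemma exists_admissible_deviation (n : ℕ) {α : ℝ} (hα1 : α < 1) :
    ∃ ε : ℝ, 0 < ε ∧ ε ≤ 1 / 2 ∧ 2 / (1 - α) ^ 2 * (n * (4 * ε) ^ 2) ≤ 1 / 2 := by
  have h1 : 0 < 1 - α := sub_pos.2 hα1
  have hc : Continuous fun ε : ℝ => 2 / (1 - α) ^ 2 * (n * (4 * ε) ^ 2) := by fun_prop
  have h2 : ∀ᶠ ε : ℝ in 𝓝[>] 0, 2 / (1 - α) ^ 2 * (n * (4 * ε) ^ 2) ≤ 1 / 2 :=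
    nhdsWithin_le_nhds ((hc.continuousAt (x := 0)).eventually (ge_mem_nhds (by norm_num)))
  obtain ⟨ε, hε, hε0, hε'⟩ := (h2.and (Ioc_mem_nhdsGT (show (0 : ℝ) < 1 / 2 by norm_num))).exists
  exact ⟨ε, hε0, hε', hε⟩

end Helpers

/-- Hölder regularity up to the totally real boundary (Step 2 of
the proof of Theorem 2.3). -/
theorem holder_up_to_totally_real_boundary (n : ℕ) (hn : 1 ≤ n) (p : ℝ) (hp : 2 < p)
    (μ' : ℝ) (hμ : μ' ∈ Set.Ioo (0 : ℝ) 1) :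
    ∃ ε > 0, ∃ C > 0,
      ∀ (J : (Fin n → ℂ) → ((Fin n → ℂ) →L[ℝ] (Fin n → ℂ)))
        (u : ℂ → (Fin n → ℂ)) (M : ℝ),
        Continuous J →
        (∀ x v, J x (J x v) = -v) →
        (∀ x, ‖J x - Jstd n‖ < ε) →
        (∀ x ∈ realSlice n, J x = Jstd n) →
        ContinuousOn u (closedHalfDisk 1) →
        (∀ z ∈ closedHalfDisk 1, ‖u z‖ ≤ M) →
        (∀ z ∈ halfDisk, DifferentiableAt ℝ u z) →
        (∀ z ∈ halfDisk, fderiv ℝ u z 1 + J (u z) (fderiv ℝ u z Complex.I) = 0) →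
        IntegrableOn
          (fun z => ‖fderiv ℝ u z 1‖ ^ 2 + ‖fderiv ℝ u z Complex.I‖ ^ 2) halfDisk →
        (∀ z ∈ closedHalfDisk 1, z.im = 0 → u z ∈ realSlice n) →
        ∀ z ∈ closedHalfDisk μ', ∀ z' ∈ closedHalfDisk μ',
          ‖u z - u z'‖ ≤ C * M * ‖z - z'‖ ^ (1 - 2 / p) := by
  obtain ⟨hμ0, hμ1⟩ := hμ
  have hp0 : 0 < p := by linarith
  have hα : 0 < 1 - 2 / p := sub_pos.2 ((div_lt_one hp0).2 hp)
  have hα1 : 1 - 2 / p < 1 := sub_lt_self _ (by positivity)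
  obtain ⟨ε, hε, hε', hκ⟩ := exists_admissible_deviation n hα1
  have hρ : 0 < (1 - μ') / 2 := by linarith
  have hD : 0 ≤ diskConstant n (1 - 2 / p) := Real.sqrt_nonneg _
  refine ⟨ε, hε, 2 * (diskConstant n (1 - 2 / p) + 1) / ((1 - μ') / 2) ^ (1 - 2 / p),
    by positivity, ?_⟩
  intro J u M _ _ hJ _ hcont hM hd hu hE hb z hz z' hz'
  have hv := isDiskMap_schwarzReflection (fun x => (hJ x).le) hcont hM hd hu hE hb
  have h := hv.norm_sub_le hε.le hε' hα hα1 hκ hρ (z₀ := z) (z₁ := z')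
    (by linarith [hz.1]) (by linarith [hz'.1])
  rwa [schwarzReflection_of_nonneg hz.2, schwarzReflection_of_nonneg hz'.2] at h
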